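/- arXiv:1006.2883 — 4 statements merged into one kernel-verified Lean document; each statement's English description precedes it below -/
import Mathlib

section
/- For a one-dimensional log-concave random variable X with standard deviation σ, the entropy satisfies h(X) > log σ - (1/2) log 2, i.e., h(X) ≥ log(C₀ σ) with C₀ = 1/√2. -/
open MeasureTheory Real

/-- Comparison of a log-concave function on the half line with the exponential of the same
mass and the same value at `0`: the second moment is at most that of the exponential. -/
lemma half_second_moment (g : ℝ → ℝ) (hg : ∀ x, 0 ≤ g x)
    (hlc : ∀ x y : ℝ, ∀ a b : ℝ, 0 ≤ a → 0 ≤ b → a + b = 1 →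
      g x ^ a * g y ^ b ≤ g (a * x + b * y))
    (h0 : 0 < g 0) (hi : IntegrableOn g (Set.Ioi 0))
    (hi2 : IntegrableOn (fun x => x ^ 2 * g x) (Set.Ioi 0)) (p : ℝ)
    (hp : ∫ x in Set.Ioi (0:ℝ), g x = p) (hp0 : 0 < p) :
    ∫ x in Set.Ioi (0:ℝ), x ^ 2 * g x ≤ 2 * p ^ 3 / g 0 ^ 2 := by
  set A := g 0 with hA
  set r := A / p with hr
  have hr0 : 0 < r := div_pos h0 hp0
  set e : ℝ → ℝ := fun x => A * exp (-(r * x)) with he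
  have hepos : ∀ x, 0 < e x := fun x => mul_pos h0 (exp_pos _)
  have e0 : ∫ x in Set.Ioi (0:ℝ), e x = p := by
    have h := Real.integral_rpow_mul_exp_neg_mul_Ioi (a := 1) (r := r) one_pos hr0
    simp only [sub_self, rpow_zero, one_mul, rpow_one, Real.Gamma_one, mul_one] at h
    rw [he, integral_const_mul, h, hr]
    field_simp
  have e2 : ∫ x in Set.Ioi (0:ℝ), x ^ 2 * e x = 2 * p ^ 3 / A ^ 2 := by
    have h := Real.integral_rpow_mul_exp_neg_mul_Ioi (a := 3) (r := r) (by norm_num) hr0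
    have hG : Real.Gamma 3 = 2 := by
      have := Real.Gamma_nat_eq_factorial 2
      norm_num at this
      simpa using this
    have h3 : (3:ℝ) - 1 = ((2:ℕ):ℝ) := by norm_num
    have h3' : (1 / r) ^ (3:ℝ) = (1 / r) ^ (3:ℕ) := by
      rw [← Real.rpow_natCast]; norm_num
    rw [hG, h3, h3'] at h
    simp only [Real.rpow_natCast] at h
    have : (fun x : ℝ => x ^ 2 * e x) = fun x => A * (x ^ 2 * exp (-(r * x))) := by
      funext x; simp only [he]; ring
    rw [this, integral_const_mul, h, hr]
    field_simp
  have ei0 : IntegrableOn e (Set.Ioi 0) := by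
    by_contra h
    have := integral_undef h
    rw [this] at e0
    exact hp0.ne e0
  have ei2 : IntegrableOn (fun x => x ^ 2 * e x) (Set.Ioi 0) := by
    by_contra h
    have h' := integral_undef h
    rw [h'] at e2
    have : 0 < 2 * p ^ 3 / A ^ 2 := by positivity
    exact this.ne e2
  have down : ∀ x y : ℝ, 0 < x → x < y → e y ≤ g y → e x ≤ g x := by
    intro x y hx hxy hy
    have hy0 : 0 < y := hx.trans hxy
    have ht0 : 0 ≤ x / y := by positivity
    have ht1 : 0 ≤ 1 - x / y := by
      rw [sub_nonneg, div_le_one hy0]; exact hxy.le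
    have h := hlc 0 y (1 - x / y) (x / y) ht1 ht0 (by ring)
    have hx' : (1 - x / y) * 0 + x / y * y = x := by field_simp; ring
    rw [hx'] at h
    refine le_trans ?_ h
    have h1 : e y ^ (x / y) ≤ g y ^ (x / y) := Real.rpow_le_rpow (hepos y).le hy ht0
    have h2 : e x = A ^ (1 - x / y) * e y ^ (x / y) := by
      simp only [he]
      rw [Real.mul_rpow h0.le (exp_pos _).le, ← mul_assoc, ← Real.rpow_add h0,
        ← Real.exp_mul]
      have : 1 - x / y + x / y = 1 := by ring
      rw [this, rpow_one]
      congr 2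
      field_simp
    rw [h2]
    exact mul_le_mul_of_nonneg_left h1 (Real.rpow_nonneg h0.le _)
  rw [← e2]
  set S : Set ℝ := {x | 0 < x ∧ e x ≤ g x} with hS
  have key : ∃ s : ℝ, ∀ᵐ x ∂(volume.restrict (Set.Ioi (0:ℝ))),
      x ^ 2 * g x - x ^ 2 * e x ≤ s * (g x - e x) := by
    by_cases hb : BddAbove S
    · by_cases hne : S.Nonempty
      · have hs0 : 0 ≤ sSup S := by
          obtain ⟨x, hx⟩ := hne
          exact hx.1.le.trans (le_csSup hb hx)
        refine ⟨(sSup S) ^ 2, ?_⟩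
        filter_upwards [ae_restrict_mem measurableSet_Ioi] with x hx
        have hx0 : 0 < x := hx
        by_cases hxS : e x ≤ g x
        · have h1 : x ≤ sSup S := le_csSup hb ⟨hx0, hxS⟩
          have h2 : x ^ 2 ≤ sSup S ^ 2 := by gcongr
          nlinarith
        · have h1 : sSup S ≤ x := by
            apply csSup_le hne
            intro y hy
            by_contra hlt
            exact hxS (down x y hx0 (not_le.mp hlt) hy.2)
          have h2 : sSup S ^ 2 ≤ x ^ 2 := by gcongr
          nlinarith
      · refine ⟨0, ?_⟩
        filter_upwards [ae_restrict_mem measurableSet_Ioi] with x hx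
        have : ¬ e x ≤ g x := fun h => hne ⟨x, hx, h⟩
        nlinarith [sq_nonneg x]
    · have hall : ∀ x : ℝ, 0 < x → e x ≤ g x := by
        intro x hx
        rw [not_bddAbove_iff] at hb
        obtain ⟨y, hy, hxy⟩ := hb x
        exact down x y hx hxy hy.2
      have hz : ∫ x in Set.Ioi (0:ℝ), (g x - e x) = 0 := by
        rw [integral_sub hi ei0, hp, e0, sub_self]
      have hnn : 0 ≤ᵐ[volume.restrict (Set.Ioi (0:ℝ))] fun x => g x - e x := by
        filter_upwards [ae_restrict_mem measurableSet_Ioi] with x hx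
        exact sub_nonneg.mpr (hall x hx)
      have := (integral_eq_zero_iff_of_nonneg_ae hnn (hi.sub ei0)).mp hz
      refine ⟨0, ?_⟩
      filter_upwards [this] with x hx
      have hx' : g x - e x = 0 := hx
      have : g x = e x := by linarith
      rw [this]; simp
  obtain ⟨s, hs⟩ := key
  have h := integral_mono_ae (hi2.sub ei2) ((hi.sub ei0).const_mul s) hs
  simp only [Pi.sub_apply] at h
  rw [integral_sub hi2 ei2, integral_const_mul, integral_sub hi ei0, hp, e0] at h
  linarith

lemma half_zero (g : ℝ → ℝ) (hg : ∀ x, 0 ≤ g x) (hi : IntegrableOn g (Set.Ioi 0))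
    (hp : ∫ x in Set.Ioi (0:ℝ), g x = 0) (w : ℝ → ℝ) :
    ∫ x in Set.Ioi (0:ℝ), w x * g x = 0 := by
  have := (integral_eq_zero_iff_of_nonneg_ae (Filter.Eventually.of_forall hg) hi).mp hp
  apply integral_eq_zero_of_ae
  filter_upwards [this] with x hx
  have : g x = 0 := hx
  simp [this]

lemma half_first (g : ℝ → ℝ) (hg : ∀ x, 0 ≤ g x)
    (hi1 : IntegrableOn (fun x => x * g x) (Set.Ioi 0))
    (hp : ∫ x in Set.Ioi (0:ℝ), x * g x = 0) :
    ∫ x in Set.Ioi (0:ℝ), g x = 0 := by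
  have hnn : 0 ≤ᵐ[volume.restrict (Set.Ioi (0:ℝ))] fun x => x * g x := by
    filter_upwards [ae_restrict_mem measurableSet_Ioi] with x hx
    exact mul_nonneg (le_of_lt hx) (hg x)
  have := (integral_eq_zero_iff_of_nonneg_ae hnn hi1).mp hp
  apply integral_eq_zero_of_ae
  filter_upwards [this, ae_restrict_mem measurableSet_Ioi] with x hx hx0
  have h1 : x * g x = 0 := hx
  have h2 : x ≠ 0 := ne_of_gt hx0
  simpa [h2] using h1

lemma split_line (F : ℝ → ℝ) (hF : Integrable F) :
    ∫ x, F x = (∫ x in Set.Ioi (0:ℝ), F (-x)) + ∫ x in Set.Ioi (0:ℝ), F x := by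
  rw [integral_comp_neg_Ioi, neg_zero, intervalIntegral.integral_Iic_add_Ioi
    hF.integrableOn hF.integrableOn]

/-- A density which is log-concave and positive at `0`: bound on the second moment. -/
lemma centered_bound (g : ℝ → ℝ) (hg : ∀ x, 0 ≤ g x)
    (hlc : ∀ x y : ℝ, ∀ a b : ℝ, 0 ≤ a → 0 ≤ b → a + b = 1 →
      g x ^ a * g y ^ b ≤ g (a * x + b * y))
    (h0 : 0 < g 0) (hi : Integrable g) (hi1 : Integrable (fun x => x * g x))
    (hi2 : Integrable (fun x => x ^ 2 * g x)) (h1 : ∫ x, g x = 1) :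
    g 0 ^ 2 * ((∫ x, x ^ 2 * g x) - (∫ x, x * g x) ^ 2) < 2 := by
  have s0 := split_line _ hi
  have s1 := split_line _ hi1
  have s2 := split_line _ hi2
  have j0 : Integrable (fun x => g (-x)) := hi.comp_neg
  have j1 : Integrable (fun x => x * g (-x)) := by
    have := hi1.comp_neg.neg
    refine this.congr (Filter.Eventually.of_forall fun x => ?_)
    simp
  have j2 : Integrable (fun x => x ^ 2 * g (-x)) := by
    have := hi2.comp_neg
    refine this.congr (Filter.Eventually.of_forall fun x => ?_)
    simp
  have r1 : ∫ x in Set.Ioi (0:ℝ), (-x) * g (-x) = -∫ x in Set.Ioi (0:ℝ), x * g (-x) := by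
    rw [← integral_neg]; simp
  simp only [neg_sq] at s2
  rw [r1] at s1
  rw [s2, s1]
  rw [h1] at s0
  have hlc' : ∀ x y : ℝ, ∀ a b : ℝ, 0 ≤ a → 0 ≤ b → a + b = 1 →
      g (-x) ^ a * g (-y) ^ b ≤ g (-(a * x + b * y)) := by
    intro x y a b ha hb hab
    have := hlc (-x) (-y) a b ha hb hab
    rwa [show a * -x + b * -y = -(a * x + b * y) by ring] at this
  have A0 := half_second_moment g hg hlc h0 hi.integrableOn hi2.integrableOn _ rfl
  have B0 := half_second_moment (fun x => g (-x)) (fun x => hg _) hlc' (by simpa using h0)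
    j0.integrableOn j2.integrableOn _ rfl
  have Az := half_zero g hg hi.integrableOn
  have Bz := half_zero (fun x => g (-x)) (fun x => hg _) j0.integrableOn
  have Af := half_first g hg hi1.integrableOn
  have Bf := half_first (fun x => g (-x)) (fun x => hg _) j1.integrableOn
  have Ann : 0 ≤ ∫ x in Set.Ioi (0:ℝ), g x := integral_nonneg hg
  have Bnn : 0 ≤ ∫ x in Set.Ioi (0:ℝ), g (-x) := integral_nonneg fun x => hg _
  have Az1 := fun h => Az h (fun x => x)
  have Az2 := fun h => Az h (fun x => x ^ 2)
  have Bz1 := fun h => Bz h (fun x => x)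
  have Bz2 := fun h => Bz h (fun x => x ^ 2)
  clear Az Bz s1 s2 r1 h1
  simp only [neg_zero] at B0
  generalize (∫ x in Set.Ioi (0:ℝ), g x) = p at *
  generalize (∫ x in Set.Ioi (0:ℝ), g (-x)) = q at *
  generalize (∫ x in Set.Ioi (0:ℝ), x * g x) = m at *
  generalize (∫ x in Set.Ioi (0:ℝ), x * g (-x)) = n at *
  generalize (∫ x in Set.Ioi (0:ℝ), x ^ 2 * g x) = u at *
  generalize (∫ x in Set.Ioi (0:ℝ), x ^ 2 * g (-x)) = v at *
  generalize g 0 = A at *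
  have hA2 : 0 < A ^ 2 := by positivity
  rcases Ann.eq_or_lt with hp | hp
  · have hq : q = 1 := by linarith
    subst hq
    rw [Az1 hp.symm, Az2 hp.symm]
    have hn : n ≠ 0 := fun h => one_ne_zero (Bf h)
    have hB := B0 one_pos
    rw [le_div_iff₀ hA2] at hB
    have : 0 < A ^ 2 * n ^ 2 := by positivity
    nlinarith
  rcases Bnn.eq_or_lt with hq | hq
  · have hp1 : p = 1 := by linarith
    subst hp1
    rw [Bz1 hq.symm, Bz2 hq.symm]
    have hn : m ≠ 0 := fun h => one_ne_zero (Af h)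
    have hB := A0 one_pos
    rw [le_div_iff₀ hA2] at hB
    have : 0 < A ^ 2 * m ^ 2 := by positivity
    nlinarith
  · have hB := B0 hq
    have hA := A0 hp
    rw [le_div_iff₀ hA2] at hA hB
    have hq1 : q = 1 - p := by linarith
    have hpq : 0 < p * q := mul_pos hp hq
    have e3 : p ^ 3 + q ^ 3 = 1 - 3 * (p * q) := by rw [hq1]; ring
    have : 0 ≤ A ^ 2 * (-n + m) ^ 2 := by positivity
    nlinarith

/-- For a one-dimensional log-concave random variable with standard
deviation σ, h(X) > log σ - (1/2) log 2, i.e. h(X) ≥ log(C₀ σ) with C₀ = 1/√2. -/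
theorem entropy_lower_bound_stddev_logconcave_1d
    (f : ℝ → ℝ)
    (hf : ∀ x, 0 ≤ f x) (hmeas : Measurable f)
    (hprob : ∫ x, f x = 1)
    (hlc : ∀ x y : ℝ, ∀ a b : ℝ, 0 ≤ a → 0 ≤ b → a + b = 1 →
      f x ^ a * f y ^ b ≤ f (a * x + b * y))
    (σ : ℝ) (hσ : 0 < σ)
    (hvar : ∫ x, (x - ∫ y, y * f y) ^ 2 * f x = σ ^ 2)
    (hent : Integrable (fun x => f x * Real.log (f x)))
    : Real.log σ - (1 / 2) * Real.log 2 < -∫ x, f x * Real.log (f x) := by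
  have hi : Integrable f := by
    by_contra h
    rw [integral_undef h] at hprob
    exact zero_ne_one hprob
  obtain ⟨μ, hμ⟩ : ∃ μ, μ = ∫ y, y * f y := ⟨_, rfl⟩
  rw [← hμ] at hvar
  have hiv : Integrable (fun x => (x - μ) ^ 2 * f x) := by
    by_contra h
    rw [integral_undef h] at hvar
    have : 0 < σ ^ 2 := by positivity
    exact this.ne hvar
  have hi1 : Integrable (fun x => x * f x) := by
    refine (hiv.add (hi.const_mul (1 + |μ|))).mono' (by fun_prop)
      (Filter.Eventually.of_forall fun x => ?_)
    simp only [Pi.add_apply, norm_eq_abs, abs_mul, abs_of_nonneg (hf x)]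
    rw [← add_mul]
    apply mul_le_mul_of_nonneg_right _ (hf x)
    have h1 : |x| ≤ |x - μ| + |μ| := by
      have := abs_add_le (x - μ) μ
      simpa using this
    nlinarith [sq_abs (x - μ), sq_nonneg (|x - μ| - 1 / 2)]
  have hpt : ∀ c, 0 < f c → Real.log (f c) < (1 / 2) * Real.log 2 - Real.log σ := by
    intro c hc
    have k0 : Integrable (fun x => f (c + x)) := hi.comp_add_left c
    have hi1c : Integrable (fun x => (x - c) * f x) := by
      refine (hi1.sub (hi.const_mul c)).congr (Filter.Eventually.of_forall fun x => ?_)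
      simp only [Pi.sub_apply]; ring
    have hdec : ∀ x, (x - c) ^ 2 * f x =
        (x - μ) ^ 2 * f x + ((2 * (μ - c)) * (x * f x) + ((c ^ 2 - μ ^ 2) * f x)) := by
      intro x; ring
    have hi2c : Integrable (fun x => (x - c) ^ 2 * f x) := by
      simp only [hdec]
      exact hiv.add ((hi1.const_mul _).add (hi.const_mul _))
    have v1 : ∫ x, (x - c) * f x = μ - c := by
      have : ∀ x, (x - c) * f x = x * f x - c * f x := fun x => by ring
      simp only [this]
      rw [integral_sub hi1 (hi.const_mul c), integral_const_mul, hprob, ← hμ, mul_one]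
    have v2 : ∫ x, (x - c) ^ 2 * f x = σ ^ 2 + (μ - c) ^ 2 := by
      simp only [hdec]
      have hs : Integrable (fun x => (2 * (μ - c)) * (x * f x) + (c ^ 2 - μ ^ 2) * f x) :=
        (hi1.const_mul _).add (hi.const_mul _)
      rw [integral_add hiv hs,
        integral_add (hi1.const_mul _) (hi.const_mul _), integral_const_mul,
        integral_const_mul, hprob, ← hμ, hvar]
      ring
    have k1 : Integrable (fun x => x * f (c + x)) := by
      have := hi1c.comp_add_left c
      simpa using this
    have k2 : Integrable (fun x => x ^ 2 * f (c + x)) := by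
      have := hi2c.comp_add_left c
      simpa using this
    have w0 := integral_add_left_eq_self (μ := volume) (fun x => f x) c
    have w1 := integral_add_left_eq_self (μ := volume) (fun x => (x - c) * f x) c
    have w2 := integral_add_left_eq_self (μ := volume) (fun x => (x - c) ^ 2 * f x) c
    simp only [add_sub_cancel_left] at w1 w2
    have hlc' : ∀ x y : ℝ, ∀ a b : ℝ, 0 ≤ a → 0 ≤ b → a + b = 1 →
        f (c + x) ^ a * f (c + y) ^ b ≤ f (c + (a * x + b * y)) := by
      intro x y a b ha hb hab
      have := hlc (c + x) (c + y) a b ha hb hab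
      have e : a * (c + x) + b * (c + y) = c + (a * x + b * y) := by
        have : a = 1 - b := by linarith
        rw [this]; ring
      rwa [e] at this
    have hfin := centered_bound (fun x => f (c + x)) (fun x => hf _) hlc' (by simpa using hc)
      k0 k1 k2 (w0.trans hprob)
    simp only [add_zero] at hfin
    rw [w1, w2, v1, v2, add_sub_cancel_right] at hfin
    have hl := Real.log_lt_log (by positivity) hfin
    rw [Real.log_mul (by positivity) (by positivity), Real.log_pow, Real.log_pow] at hl
    push_cast at hl
    linarith
  set L := (1 / 2) * Real.log 2 - Real.log σ with hL
  have hpos : 0 < ∫ x, (L * f x - f x * Real.log (f x)) := by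
    have hnn : ∀ x, 0 ≤ L * f x - f x * Real.log (f x) := by
      intro x
      rcases (hf x).eq_or_lt with h | h
      · simp [← h]
      · nlinarith [hpt x h]
    refine lt_of_le_of_ne (integral_nonneg hnn) fun hz => ?_
    have hae := (integral_eq_zero_iff_of_nonneg hnn ((hi.const_mul L).sub hent)).mp hz.symm
    have : f =ᵐ[volume] 0 := by
      filter_upwards [hae] with x hx
      have hx' : L * f x - f x * Real.log (f x) = 0 := hx
      rcases (hf x).eq_or_lt with h | h
      · exact h.symm
      · nlinarith [hpt x h]
    rw [integral_congr_ae this] at hprob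
    simp at hprob
  rw [integral_sub (hi.const_mul L) hent, integral_const_mul, hprob] at hpos
  linarith
end

section
/- If u is a positive concave function on an interval (a,b) ⊂ R and α > 0, then the measure on (a,b) with density u^α is 1/(α+1)-concave: for Borel sets A, B ⊆ (a,b) of positive measure and t ∈ (0,1), μ(tA+(1-t)B)^{1/(α+1)} ≥ t μ(A)^{1/(α+1)} + (1-t) μ(B)^{1/(α+1)}. -/
open MeasureTheory Real ENNReal
open scoped Pointwise

theorem bm_compact (K L : Set ℝ) (hK : IsCompact K) (hL : IsCompact L) (hKn : K.Nonempty)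
    (hLn : L.Nonempty) : volume K + volume L ≤ volume (K + L) := by
  obtain ⟨k, hk⟩ := hK.exists_isGreatest hKn
  obtain ⟨l, hl⟩ := hL.exists_isLeast hLn
  have h1 : volume ((fun x => l + x) '' K) = volume K := by
    simp
  have h2 : volume ((fun x => k + x) '' L) = volume L := by
    simp
  have hae : AEDisjoint volume ((fun x => l + x) '' K) ((fun x => k + x) '' L) := by
    have : ((fun x => l + x) '' K) ∩ ((fun x => k + x) '' L) ⊆ {k + l} := by
      rintro z ⟨⟨x, hx, rfl⟩, ⟨y, hy, hxy⟩⟩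
      have := hk.2 hx
      have := hl.2 hy
      simp only [Set.mem_singleton_iff] at *
      linarith
    exact measure_mono_null this (by simp)
  have hm : MeasurableSet ((fun x => k + x) '' L) :=
    (hL.image (by fun_prop)).measurableSet
  rw [← h1, ← h2, ← measure_union₀ hm.nullMeasurableSet hae]
  apply measure_mono
  rintro z (⟨x, hx, rfl⟩ | ⟨x, hx, rfl⟩)
  · exact ⟨x, hx, l, hl.1, add_comm _ _⟩
  · exact ⟨k, hk.1, x, hx, rfl⟩

theorem bm_measurable (S T : Set ℝ) (hS : MeasurableSet S) (hT : MeasurableSet T)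
    (hSn : S.Nonempty) (hTn : T.Nonempty) : volume S + volume T ≤ volume (S + T) := by
  obtain ⟨s, hs⟩ := hSn
  obtain ⟨t, ht⟩ := hTn
  rw [hS.measure_eq_iSup_isCompact, hT.measure_eq_iSup_isCompact]
  simp only [iSup_and']
  refine ENNReal.biSup_add_biSup_le' (p := fun K => K ⊆ S ∧ IsCompact K)
    (q := fun K => K ⊆ T ∧ IsCompact K) ⟨∅, by simp⟩ ⟨∅, by simp⟩ ?_
  rintro K ⟨hKS, hK⟩ L ⟨hLT, hL⟩
  calc volume K + volume L ≤ volume (insert s K) + volume (insert t L) := by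
        gcongr <;> exact Set.subset_insert _ _
    _ ≤ volume (insert s K + insert t L) :=
        bm_compact _ _ (hK.insert s) (hL.insert t) (Set.insert_nonempty _ _)
          (Set.insert_nonempty _ _)
    _ ≤ _ := measure_mono (Set.add_subset_add (Set.insert_subset hs hKS) (Set.insert_subset ht hLT))

theorem bm_scaled (S T : Set ℝ) (hS : MeasurableSet S) (hT : MeasurableSet T)
    (hSn : S.Nonempty) (hTn : T.Nonempty) (t : ℝ) (h0 : 0 < t) (h1 : t < 1) :
    ENNReal.ofReal t * volume S + ENNReal.ofReal (1 - t) * volume T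
      ≤ volume (t • S + (1 - t) • T) := by
  have := bm_measurable (t • S) ((1 - t) • T) (hS.const_smul₀ t) (hT.const_smul₀ _)
    hSn.smul_set hTn.smul_set
  simpa [Measure.addHaar_smul, abs_of_pos h0, abs_of_pos (sub_pos.2 h1)] using this

theorem layer (a b α : ℝ) (hα : 0 < α) (u : ℝ → ℝ)
    (hupos : ∀ x ∈ Set.Ioo a b, 0 < u x)
    (hc : ContinuousOn u (Set.Ioo a b))
    (S : Set ℝ) (hS : MeasurableSet S) (hSs : S ⊆ Set.Ioo a b) (m : ℝ) (hm : 0 < m) :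
    ENNReal.ofReal (m ^ (-α)) * (volume.withDensity
      (fun x => ENNReal.ofReal ((Set.Ioo a b).indicator (fun y => u y ^ α) x))) S
    = ENNReal.ofReal α * ∫⁻ s in Set.Ioi 0,
        volume (S ∩ {x | s * m < u x}) * ENNReal.ofReal (s ^ (α - 1)) := by
  have hmeas : AEMeasurable u (volume.restrict S) :=
    (hc.mono hSs).aemeasurable hS
  have key := lintegral_rpow_eq_lintegral_meas_lt_mul (volume.restrict S) (f := fun x => u x / m)
    ((ae_restrict_iff' hS).2 (Filter.Eventually.of_forall fun x hx =>
      (div_pos (hupos x (hSs hx)) hm).le)) (hmeas.div_const m) hα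
  rw [withDensity_apply _ hS, ← lintegral_const_mul' _ _ ENNReal.ofReal_ne_top]
  trans ∫⁻ x in S, ENNReal.ofReal ((u x / m) ^ α)
  · refine setLIntegral_congr_fun hS fun x hx => ?_
    have hx' := hSs hx
    simp only [Set.indicator_of_mem hx']
    rw [← ENNReal.ofReal_mul (by positivity), Real.div_rpow (hupos x hx').le hm.le,
      Real.rpow_neg hm.le]
    congr 1
    field_simp
  · rw [key]
    congr 1
    refine setLIntegral_congr_fun measurableSet_Ioi fun s hs => ?_
    have : {x | s < u x / m} = {x | s * m < u x} := by
      ext x; simp [lt_div_iff₀ hm]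
    simp only [this]
    rw [Measure.restrict_apply' hS, Set.inter_comm]

theorem holder_step (t p M₁ M₂ : ℝ) (x y z : ℝ≥0∞) (h0 : 0 < t) (h1 : t < 1) (hp : 1 < p)
    (hM₁ : 0 < M₁) (hM₂ : 0 < M₂)
    (h : ENNReal.ofReal t * (ENNReal.ofReal (M₁ ^ (-(p - 1))) * x)
      + ENNReal.ofReal (1 - t) * (ENNReal.ofReal (M₂ ^ (-(p - 1))) * y)
      ≤ ENNReal.ofReal ((t * M₁ + (1 - t) * M₂) ^ (-(p - 1))) * z) :
    ENNReal.ofReal t * x ^ (1 / p) + ENNReal.ofReal (1 - t) * y ^ (1 / p) ≤ z ^ (1 / p) := by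
  have h1' : 0 < 1 - t := sub_pos.2 h1
  set M := t * M₁ + (1 - t) * M₂ with hM
  have hMp : 0 < M := by positivity
  have hp0 : 0 < p := by linarith
  have aux : ∀ (r N : ℝ) (w : ℝ≥0∞), 0 < r → 0 < N → ENNReal.ofReal r * w ^ (1 / p) =
      ENNReal.ofReal (r * N / M) * (ENNReal.ofReal (M / N) * w ^ (1 / p)) := by
    intro r N w hr hN
    rw [← mul_assoc, ← ENNReal.ofReal_mul (by positivity)]
    congr 2
    field_simp
  have aux2 : ∀ (r N : ℝ) (w : ℝ≥0∞), 0 < r → 0 < N →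
      ENNReal.ofReal (r * N / M) * (ENNReal.ofReal (M / N) * w ^ (1 / p)) ^ p =
      ENNReal.ofReal (M ^ (p - 1)) * (ENNReal.ofReal r * (ENNReal.ofReal (N ^ (-(p - 1))) * w)) := by
    intro r N w hr hN
    rw [ENNReal.mul_rpow_of_nonneg _ _ hp0.le, ← ENNReal.rpow_mul, one_div_mul_cancel hp0.ne',
      ENNReal.rpow_one, ENNReal.ofReal_rpow_of_pos (by positivity), ← mul_assoc, ← mul_assoc,
      ← mul_assoc, ← ENNReal.ofReal_mul (by positivity), ← ENNReal.ofReal_mul (by positivity),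
      ← ENNReal.ofReal_mul (by positivity)]
    congr 2
    rw [Real.div_rpow hMp.le hN.le, Real.rpow_neg hN.le, Real.rpow_sub_one hMp.ne',
      Real.rpow_sub_one hN.ne']
    have := Real.rpow_pos_of_pos hN p
    field_simp
  rw [one_div, ENNReal.le_rpow_inv_iff hp0, ← one_div, aux t M₁ x h0 hM₁, aux (1 - t) M₂ y h1' hM₂]
  refine (ENNReal.rpow_arith_mean_le_arith_mean2_rpow _ _ _ _ ?_ hp.le).trans ?_
  · rw [← ENNReal.ofReal_add (by positivity) (by positivity), ← add_div, ← hM, div_self hMp.ne',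
      ENNReal.ofReal_one]
  · rw [aux2 t M₁ x h0 hM₁, aux2 (1 - t) M₂ y h1' hM₂, ← mul_add]
    refine (mul_le_mul_right h _).trans (le_of_eq ?_)
    rw [← mul_assoc, ← ENNReal.ofReal_mul (by positivity), ← Real.rpow_add hMp]
    simp

theorem concave_power_density_kappa_concave
    (a b : ℝ) (hab : a < b) (α : ℝ) (hα : 0 < α)
    (u : ℝ → ℝ)
    (hupos : ∀ x ∈ Set.Ioo a b, 0 < u x)
    (huconc : ConcaveOn ℝ (Set.Ioo a b) u)
    (μ : Measure ℝ)
    (hμ : μ = volume.withDensity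
      (fun x => ENNReal.ofReal ((Set.Ioo a b).indicator (fun y => u y ^ α) x)))
    (A B : Set ℝ) (hA : MeasurableSet A) (hB : MeasurableSet B)
    (hAsub : A ⊆ Set.Ioo a b) (hBsub : B ⊆ Set.Ioo a b)
    (hApos : 0 < μ A) (hBpos : 0 < μ B)
    (t : ℝ) (ht : t ∈ Set.Ioo (0 : ℝ) 1)
    : ENNReal.ofReal t * μ A ^ ((1 : ℝ) / (α + 1))
        + ENNReal.ofReal (1 - t) * μ B ^ ((1 : ℝ) / (α + 1))
      ≤ μ (Set.image2 (fun x y => t * x + (1 - t) * y) A B) ^ ((1 : ℝ) / (α + 1)) := by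
  obtain ⟨h0, h1⟩ := ht
  have h1' : 0 < 1 - t := sub_pos.2 h1
  have hc : ContinuousOn u (Set.Ioo a b) := huconc.continuousOn isOpen_Ioo
  have hbd : ∀ x ∈ Set.Ioo a b, u x ≤ 2 * u ((a + b) / 2) := by
    intro x hx
    have hy : a + b - x ∈ Set.Ioo a b := ⟨by linarith [hx.2], by linarith [hx.1]⟩
    have := huconc.2 hx hy (show (0 : ℝ) ≤ 1 / 2 by norm_num) (show (0 : ℝ) ≤ 1 / 2 by norm_num)
      (by norm_num)
    simp only [smul_eq_mul] at this
    have e : 1 / 2 * x + 1 / 2 * (a + b - x) = (a + b) / 2 := by ring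
    rw [e] at this
    linarith [hupos _ hy]
  have hsup : ∀ S ⊆ Set.Ioo a b, 0 < μ S → ∃ M, 0 < M ∧ IsLUB (u '' S) M := by
    intro S hS hpos
    have hne : S.Nonempty := nonempty_of_measure_ne_zero hpos.ne'
    have hlub := Real.isLUB_sSup (hne.image u)
      ⟨_, by rintro _ ⟨x, hx, rfl⟩; exact hbd x (hS hx)⟩
    obtain ⟨x, hx⟩ := hne
    exact ⟨_, (hupos x (hS hx)).trans_le (hlub.1 ⟨x, hx, rfl⟩), hlub⟩
  obtain ⟨M₁, hM₁, hl₁⟩ := hsup A hAsub hApos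
  obtain ⟨M₂, hM₂, hl₂⟩ := hsup B hBsub hBpos
  have hM : 0 < t * M₁ + (1 - t) * M₂ := by positivity
  set C := Set.image2 (fun x y => t * x + (1 - t) * y) A B with hC
  have hCsub : C ⊆ Set.Ioo a b := by
    rintro _ ⟨x, hx, y, hy, rfl⟩
    exact huconc.1 (hAsub hx) (hBsub hy) h0.le h1'.le (by ring)
  set D := toMeasurable μ C ∩ Set.Ioo a b with hD
  have hDm : MeasurableSet D := (measurableSet_toMeasurable _ _).inter measurableSet_Ioo
  have hDsub : D ⊆ Set.Ioo a b := Set.inter_subset_right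
  have hCD : C ⊆ D := Set.subset_inter (subset_toMeasurable _ _) hCsub
  have hDC : μ D ≤ μ C := (measure_mono Set.inter_subset_left).trans (measure_toMeasurable C).le
  have hlev : ∀ S ⊆ Set.Ioo a b, MeasurableSet S → ∀ r, MeasurableSet (S ∩ {x | r < u x}) := by
    intro S hS hSm r
    have : S ∩ {x | r < u x} = S ∩ (Set.Ioo a b ∩ u ⁻¹' Set.Ioi r) := by
      ext x
      constructor
      · rintro ⟨h, h'⟩
        exact ⟨h, hS h, h'⟩
      · rintro ⟨h, _, h'⟩
        exact ⟨h, h'⟩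
    rw [this]
    exact hSm.inter (hc.isOpen_inter_preimage isOpen_Ioo isOpen_Ioi).measurableSet
  have hmain : ∀ s : ℝ, 0 < s →
      ENNReal.ofReal t * volume (A ∩ {x | s * M₁ < u x})
        + ENNReal.ofReal (1 - t) * volume (B ∩ {x | s * M₂ < u x})
      ≤ volume (D ∩ {x | s * (t * M₁ + (1 - t) * M₂) < u x}) := by
    intro s hs
    rcases lt_or_ge s 1 with hs1 | hs1
    · have hne : ∀ (S : Set ℝ) (N : ℝ), 0 < N → IsLUB (u '' S) N →
          (S ∩ {x | s * N < u x}).Nonempty := by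
        intro S N hN hl
        obtain ⟨_, ⟨x, hx, rfl⟩, hlt, -⟩ := hl.exists_between (b := s * N) (by nlinarith)
        exact ⟨x, hx, hlt⟩
      refine (bm_scaled _ _ (hlev A hAsub hA _) (hlev B hBsub hB _) (hne A M₁ hM₁ hl₁)
        (hne B M₂ hM₂ hl₂) t h0 h1).trans (measure_mono ?_)
      rintro _ ⟨_, ⟨x, ⟨hx, hxs⟩, rfl⟩, _, ⟨y, ⟨hy, hys⟩, rfl⟩, rfl⟩
      refine ⟨hCD ⟨x, hx, y, hy, rfl⟩, ?_⟩
      have := huconc.2 (hAsub hx) (hBsub hy) h0.le h1'.le (by ring)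
      simp only [smul_eq_mul, Set.mem_ofPred_eq] at this hxs hys ⊢
      nlinarith [mul_lt_mul_of_pos_left hxs h0, mul_lt_mul_of_pos_left hys h1']
    · have hem : ∀ (S : Set ℝ) (N : ℝ), 0 < N → IsLUB (u '' S) N →
          S ∩ {x | s * N < u x} = ∅ := by
        intro S N hN hl
        ext x
        simp only [Set.mem_inter_iff, Set.mem_ofPred_eq, Set.mem_empty_iff_false, iff_false, not_and,
          not_lt]
        intro hx
        have := hl.1 ⟨x, hx, rfl⟩
        nlinarith
      simp [hem A M₁ hM₁ hl₁, hem B M₂ hM₂ hl₂]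
  refine (holder_step t (α + 1) M₁ M₂ (μ A) (μ B) (μ D) h0 h1 (by linarith) hM₁ hM₂ ?_).trans
    (ENNReal.rpow_le_rpow hDC (by positivity))
  rw [add_sub_cancel_right, hμ, layer a b α hα u hupos hc A hA hAsub M₁ hM₁,
    layer a b α hα u hupos hc B hB hBsub M₂ hM₂, ← hμ]
  conv_rhs => rw [hμ]
  rw [layer a b α hα u hupos hc D hDm hDsub _ hM]
  rw [mul_left_comm, mul_left_comm (ENNReal.ofReal (1 - t)), ← mul_add]
  gcongr
  rw [← lintegral_const_mul' _ _ ENNReal.ofReal_ne_top,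
    ← lintegral_const_mul' _ _ ENNReal.ofReal_ne_top]
  refine (le_lintegral_add _ _).trans (setLIntegral_mono' measurableSet_Ioi fun s hs => ?_)
  rw [← mul_assoc, ← mul_assoc, ← add_mul]
  gcongr
  exact hmain s hs
end

section
/- For a > 0 and β > n, the multivariate Pareto density f_{β,a}(x) = Z_n(β,a)^{-1} (a + x₁ + ⋯ + x_n)^{-β} on the positive orthant satisfies h(f_{β,a}) + log ‖f_{β,a}‖_∞ = β · Σ_{i=1}^n 1/(β-i). -/
open MeasureTheory Real

noncomputable abbrev orthM (n : ℕ) : Measure (Fin n → ℝ) :=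
  Measure.pi fun _ : Fin n => (volume : Measure ℝ).restrict (Set.Ioi 0)

lemma orthM_pos (n : ℕ) : ∀ᵐ x ∂(orthM n), ∀ i, 0 < x i := by
  have h : orthM n = volume.restrict (Set.univ.pi fun _ => Set.Ioi 0) := by
    rw [volume_pi, Measure.restrict_pi_pi]
  rw [h]
  filter_upwards [ae_restrict_mem (MeasurableSet.univ_pi fun _ => measurableSet_Ioi)] with x hx i
  exact hx i (Set.mem_univ i)

lemma one_int {a s : ℝ} (ha : 0 < a) (hs : 1 < s) :
    Integrable (fun x : ℝ => (a + x) ^ (-s)) (volume.restrict (Set.Ioi 0)) := by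
  have := integrableOn_add_rpow_Ioi_of_lt (a := -s) (c := 0) (m := a) (by linarith) (by linarith)
  rw [IntegrableOn] at this
  simpa only [add_comm] using this

lemma tendsto_shift {a s : ℝ} (hs : 1 < s) :
    Filter.Tendsto (fun x : ℝ => (a + x) ^ (1 - s)) Filter.atTop (nhds 0) := by
  have h1 := tendsto_rpow_neg_atTop (y := s - 1) (by linarith)
  have h2 := h1.comp (Filter.tendsto_atTop_add_const_left Filter.atTop a Filter.tendsto_id)
  simpa [Function.comp_def] using h2

lemma one_val {a s : ℝ} (ha : 0 < a) (hs : 1 < s) :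
    ∫ x in Set.Ioi (0:ℝ), (a + x) ^ (-s) = a ^ (1 - s) / (s - 1) := by
  have hd : ∀ x : ℝ, 0 ≤ x → HasDerivAt (fun x : ℝ => -((a + x) ^ (1 - s)) / (s - 1))
      ((a + x) ^ (-s)) x := by
    intro x hx
    have h := (((hasDerivAt_id x).const_add a).rpow_const (p := 1 - s)
      (Or.inl (by simp; positivity))).neg.div_const (s - 1)
    refine h.congr_deriv ?_
    have : s - 1 ≠ 0 := by linarith
    rw [show 1 - s - 1 = -s by ring]
    simp
    field_simp
    ring
  rw [integral_Ioi_of_hasDerivAt_of_tendsto (hd 0 le_rfl).continuousAt.continuousWithinAt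
    (fun x hx => hd x (le_of_lt hx)) (one_int ha hs) (m := 0)]
  · simp; ring
  · simpa using ((tendsto_shift (a := a) hs).neg.div_const (s - 1))

lemma log_bound {a t β ε : ℝ} (ha : 0 < a) (ht : a ≤ t) (hε : 0 < ε) :
    ‖t ^ (-β) * log t‖ ≤ |log a| * t ^ (-β) + a ^ (-ε) / ε * t ^ (-(β - ε)) := by
  have ht0 : 0 < t := ha.trans_le ht
  have h1 : log t = log a + log (t / a) := by rw [log_div ht0.ne' ha.ne']; ring
  have h2 : 0 ≤ log (t / a) := log_nonneg (by rw [le_div_iff₀ ha]; linarith)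
  have h3 := log_le_rpow_div (x := t / a) (by positivity) hε
  have h4 : |log t| ≤ |log a| + (t / a) ^ ε / ε := by
    rw [h1]
    refine (abs_add_le _ _).trans ?_
    rw [abs_of_nonneg h2]; linarith
  have h5 : t ^ (-(β - ε)) = t ^ (-β) * t ^ ε := by rw [← rpow_add ht0]; congr 1; ring
  rw [norm_mul, norm_of_nonneg (by positivity), norm_eq_abs, h5]
  have h6 : (t / a) ^ ε = t ^ ε * a ^ (-ε) := by
    rw [div_rpow ht0.le ha.le, rpow_neg ha.le]; rfl
  rw [h6] at h4
  have h7 : 0 < t ^ (-β) := by positivity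
  calc t ^ (-β) * |log t| ≤ t ^ (-β) * (|log a| + t ^ ε * a ^ (-ε) / ε) := by gcongr
    _ = _ := by ring

lemma one_log_int {a s : ℝ} (ha : 0 < a) (hs : 1 < s) :
    Integrable (fun x : ℝ => (a + x) ^ (-s) * log (a + x)) (volume.restrict (Set.Ioi 0)) := by
  have h1 := (one_int ha hs).const_mul |log a|
  have h2 := (one_int (s := s - (s - 1) / 2) ha (by linarith)).const_mul
    (a ^ (-((s - 1) / 2)) / ((s - 1) / 2))
  refine (h1.add h2).mono' (by fun_prop) ?_
  filter_upwards [ae_restrict_mem measurableSet_Ioi] with x hx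
  have hx' : (0:ℝ) < x := hx
  exact log_bound ha (by linarith) (by linarith)

lemma one_log_val {a s : ℝ} (ha : 0 < a) (hs : 1 < s) :
    ∫ x in Set.Ioi (0:ℝ), (a + x) ^ (-s) * log (a + x)
      = a ^ (1 - s) / (s - 1) * (log a + 1 / (s - 1)) := by
  have hs' : s - 1 ≠ 0 := by linarith
  have hd : ∀ x : ℝ, 0 ≤ x → HasDerivAt
      (fun x : ℝ => -((a + x) ^ (1 - s)) / (s - 1) * (log (a + x) + 1 / (s - 1)))
      ((a + x) ^ (-s) * log (a + x)) x := by
    intro x hx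
    have hne : a + x ≠ 0 := by positivity
    have h := (((hasDerivAt_id x).const_add a).rpow_const (p := 1 - s)
      (Or.inl (by simpa using hne))).neg.div_const (s - 1)
    have h' := (((hasDerivAt_id x).const_add a).log (by simpa using hne)).add_const (1 / (s - 1))
    refine (h.mul h').congr_deriv ?_
    rw [show 1 - s - 1 = -s by ring]
    have : (a + x) ^ (1 - s) = (a + x) ^ (-s) * (a + x) := by
      rw [show 1 - s = -s + 1 by ring, rpow_add_one hne]
    simp [this]
    field_simp
    ring
  rw [integral_Ioi_of_hasDerivAt_of_tendsto (hd 0 le_rfl).continuousAt.continuousWithinAt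
    (fun x hx => hd x (le_of_lt hx)) (one_log_int ha hs) (m := 0)]
  · simp; ring
  · have h1 := (isLittleO_log_rpow_atTop (r := s - 1) (by linarith)).tendsto_div_nhds_zero
    have h2 := h1.comp (Filter.tendsto_atTop_add_const_left Filter.atTop a Filter.tendsto_id)
    have h3 := ((h2.add ((tendsto_shift (a := a) hs).mul_const (1 / (s - 1)))).neg.div_const (s - 1))
    simp only [zero_mul, add_zero, neg_zero, zero_div] at h3
    refine h3.congr' ?_
    filter_upwards [Filter.eventually_gt_atTop 0] with x hx
    have : (a + x) ^ (1 - s) = ((a + x) ^ (s - 1))⁻¹ := by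
      rw [← rpow_neg (by positivity)]; congr 1; ring
    simp only [Function.comp, id, this]
    ring

lemma sum_succ_symm {n : ℕ} (g : ℝ → ℝ) (x : Fin (n + 1) → ℝ) (a : ℝ) :
    g (a + ∑ i, x i) = (fun p : ℝ × (Fin n → ℝ) => g (a + p.1 + ∑ i, p.2 i))
      (MeasurableEquiv.piFinSuccAbove (fun _ : Fin (n + 1) => ℝ) 0 x) := by
  simp [Fin.sum_univ_succ, MeasurableEquiv.piFinSuccAbove_apply, Fin.insertNthEquiv, add_assoc,
    Fin.tail]

lemma succ_integrable {n : ℕ} (g : ℝ → ℝ) (a : ℝ) :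
    Integrable (fun x => g (a + ∑ i, x i)) (orthM (n + 1)) ↔
    Integrable (fun p : ℝ × (Fin n → ℝ) => g (a + p.1 + ∑ i, p.2 i))
      ((volume.restrict (Set.Ioi 0)).prod (orthM n)) := by
  have hm := measurePreserving_piFinSuccAbove
    (fun _ : Fin (n + 1) => (volume : Measure ℝ).restrict (Set.Ioi 0)) 0
  rw [← hm.integrable_comp_emb (MeasurableEquiv.measurableEmbedding _)]
  refine iff_of_eq (congrArg (fun F => Integrable F _) ?_)
  funext x
  exact sum_succ_symm g x a

lemma succ_integral {n : ℕ} (g : ℝ → ℝ) (a : ℝ) :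
    ∫ x, g (a + ∑ i, x i) ∂(orthM (n + 1)) =
    ∫ p : ℝ × (Fin n → ℝ), g (a + p.1 + ∑ i, p.2 i)
      ∂((volume.restrict (Set.Ioi 0)).prod (orthM n)) := by
  have hm := measurePreserving_piFinSuccAbove
    (fun _ : Fin (n + 1) => (volume : Measure ℝ).restrict (Set.Ioi 0)) 0
  rw [← hm.integral_comp']
  refine integral_congr_ae (Filter.Eventually.of_forall fun x => ?_)
  exact sum_succ_symm g x a

lemma pow_main (n : ℕ) : ∀ (a β : ℝ), 0 < a → (n : ℝ) < β →
    Integrable (fun x => (a + ∑ i, x i) ^ (-β)) (orthM n) ∧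
    ∫ x, (a + ∑ i, x i) ^ (-β) ∂(orthM n)
      = a ^ ((n : ℝ) - β) / ∏ i : Fin n, (β - (i + 1 : ℕ)) := by
  induction n with
  | zero =>
    intro a β ha hβ
    have h0 : orthM 0 = Measure.dirac isEmptyElim := Measure.pi_of_empty _ _
    rw [h0]
    simp
  | succ n ih =>
    intro a β ha hβ
    push_cast at hβ
    have hn : (n : ℝ) < β := by linarith
    have hI : Integrable (fun p : ℝ × (Fin n → ℝ) => (a + p.1 + ∑ i, p.2 i) ^ (-β))
      ((volume.restrict (Set.Ioi 0)).prod (orthM n)) := by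
      rw [integrable_prod_iff (Measurable.aestronglyMeasurable (by fun_prop))]
      constructor
      · filter_upwards [ae_restrict_mem measurableSet_Ioi] with x hx
        have hx' : (0:ℝ) < x := hx
        exact (ih (a + x) β (by linarith) hn).1
      · have := (one_int (s := β - n) ha (by linarith)).div_const
          (∏ i : Fin n, (β - (i + 1 : ℕ)))
        refine this.congr ?_
        filter_upwards [ae_restrict_mem measurableSet_Ioi] with x hx
        have hx' : (0:ℝ) < x := hx
        have h1 := (ih (a + x) β (by linarith) hn).2
        rw [neg_sub, ← h1]
        refine integral_congr_ae ?_
        filter_upwards [orthM_pos n] with y hy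
        have : 0 ≤ ∑ i, y i := Finset.sum_nonneg fun i _ => (hy i).le
        rw [norm_of_nonneg]
        positivity
    refine ⟨(succ_integrable (fun t => t ^ (-β)) a).2 hI, ?_⟩
    rw [succ_integral (fun t => t ^ (-β)) a, integral_prod _ hI]
    have : ∀ᵐ x ∂(volume.restrict (Set.Ioi (0:ℝ))),
        ∫ y, (a + x + ∑ i, y i) ^ (-β) ∂(orthM n)
          = (a + x) ^ (-(β - n)) / ∏ i : Fin n, (β - (i + 1 : ℕ)) := by
      filter_upwards [ae_restrict_mem measurableSet_Ioi] with x hx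
      have hx' : (0:ℝ) < x := hx
      rw [neg_sub]
      exact (ih (a + x) β (by linarith) hn).2
    rw [integral_congr_ae this, integral_div, one_val ha (by linarith), Fin.prod_univ_castSucc]
    simp only [Fin.val_castSucc, Fin.val_last]
    push_cast
    rw [div_div, show 1 - (β - (n:ℝ)) = n + 1 - β by ring]
    congr 1
    ring

lemma log_int (n : ℕ) {a β : ℝ} (ha : 0 < a) (hβ : (n : ℝ) < β) :
    Integrable (fun x => (a + ∑ i, x i) ^ (-β) * log (a + ∑ i, x i)) (orthM n) := by
  have h1 := (pow_main n a β ha hβ).1.const_mul |log a|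
  have h2 := (pow_main n a (β - (β - n) / 2) ha (by linarith)).1.const_mul
    (a ^ (-((β - n) / 2)) / ((β - n) / 2))
  refine (h1.add h2).mono' (by fun_prop) ?_
  filter_upwards [orthM_pos n] with y hy
  have : 0 ≤ ∑ i, y i := Finset.sum_nonneg fun i _ => (hy i).le
  exact log_bound ha (by linarith) (by linarith)

lemma log_main (n : ℕ) : ∀ (a β : ℝ), 0 < a → (n : ℝ) < β →
    ∫ x, (a + ∑ i, x i) ^ (-β) * log (a + ∑ i, x i) ∂(orthM n)
      = a ^ ((n : ℝ) - β) / (∏ i : Fin n, (β - (i + 1 : ℕ)))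
        * (log a + ∑ i : Fin n, 1 / (β - (i + 1 : ℕ))) := by
  induction n with
  | zero =>
    intro a β ha hβ
    have h0 : orthM 0 = Measure.dirac isEmptyElim := Measure.pi_of_empty _ _
    rw [h0]
    simp
  | succ n ih =>
    intro a β ha hβ
    have hI := (succ_integrable (fun t => t ^ (-β) * log t) a).1 (log_int (n + 1) ha hβ)
    push_cast at hβ
    have hn : (n : ℝ) < β := by linarith
    rw [succ_integral (fun t => t ^ (-β) * log t) a, integral_prod _ hI]
    set P := ∏ i : Fin n, (β - (i + 1 : ℕ)) with hP
    set S := ∑ i : Fin n, 1 / (β - (i + 1 : ℕ)) with hS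
    have : ∀ᵐ x ∂(volume.restrict (Set.Ioi (0:ℝ))),
        ∫ y, (a + x + ∑ i, y i) ^ (-β) * log (a + x + ∑ i, y i) ∂(orthM n)
          = P⁻¹ * ((a + x) ^ (-(β - n)) * log (a + x)) + (P⁻¹ * S) * (a + x) ^ (-(β - n)) := by
      filter_upwards [ae_restrict_mem measurableSet_Ioi] with x hx
      have hx' : (0:ℝ) < x := hx
      rw [ih (a + x) β (by linarith) hn, neg_sub]
      ring
    rw [integral_congr_ae this, integral_add ((one_log_int ha (by linarith)).const_mul _)
      ((one_int ha (by linarith)).const_mul _), integral_const_mul, integral_const_mul,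
      one_val ha (by linarith), one_log_val ha (by linarith), Fin.prod_univ_castSucc,
      Fin.sum_univ_castSucc]
    simp only [Fin.val_castSucc, Fin.val_last]
    rw [← hP, ← hS]
    push_cast
    rw [show 1 - (β - (n:ℝ)) = n + 1 - β by ring, show β - (n:ℝ) - 1 = β - (n + 1) by ring]
    generalize β - ((n:ℝ) + 1) = q
    rw [div_eq_mul_inv _ (P * q), mul_inv]
    ring

lemma essSup_val (n : ℕ) {a β c : ℝ} (ha : 0 < a) (hβ : 0 < β) (hc : 0 < c)
    (f : EuclideanSpace ℝ (Fin n) → ℝ)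
    (hfdef : f = fun x => if ∀ i, 0 < x i then c * (a + ∑ i, x i) ^ (-β) else 0) :
    essSup f volume = c * a ^ (-β) := by
  have hle : ∀ x, f x ≤ c * a ^ (-β) := by
    intro x
    rw [hfdef]
    dsimp only
    split_ifs with h
    · have : 0 ≤ ∑ i, x i := Finset.sum_nonneg fun i _ => (h i).le
      have := rpow_le_rpow_of_nonpos (x := a) (y := a + ∑ i, x i) (z := -β) ha
        (by linarith) (by linarith)
      gcongr
    · positivity
  have key : ∀ b < c * a ^ (-β), volume {x | b < f x} ≠ 0 := by
    intro b hb
    have hcont : ContinuousAt (fun x : EuclideanSpace ℝ (Fin n) => c * (a + ∑ i, x i) ^ (-β)) 0 := by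
      refine continuousAt_const.mul (ContinuousAt.rpow_const (by fun_prop) (Or.inl ?_))
      simpa using ha.ne'
    have hev := hcont.eventually (lt_mem_nhds (a := b) (by simpa using hb))
    obtain ⟨U, hU, hUo, h0⟩ := mem_nhds_iff.1 hev
    set O : Set (EuclideanSpace ℝ (Fin n)) := ⋂ i, {x | 0 < x i} with hO
    have hOo : IsOpen O := isOpen_iInter_of_finite fun i => isOpen_lt continuous_const (by fun_prop)
    have hne : (U ∩ O).Nonempty := by
      have ht : Filter.Tendsto (fun t : ℝ => (WithLp.toLp 2 (fun _ => t) : EuclideanSpace ℝ (Fin n)))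
          (nhdsWithin 0 (Set.Ioi 0)) (nhds 0) := by
        have : Continuous (fun t : ℝ => (WithLp.toLp 2 (fun _ => t) : EuclideanSpace ℝ (Fin n))) := by
          fun_prop
        exact (this.tendsto' 0 0 rfl).mono_left nhdsWithin_le_nhds
      obtain ⟨t, h1, h2⟩ := ((ht.eventually (hUo.mem_nhds h0)).and self_mem_nhdsWithin).exists
      exact ⟨_, h1, Set.mem_iInter.2 fun i => h2⟩
    have hpos := (hUo.inter hOo).measure_pos volume hne
    refine (hpos.trans_le (measure_mono ?_)).ne'
    rintro x ⟨hx, hx'⟩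
    have h3 : b < c * (a + ∑ i, x i) ^ (-β) := hU hx
    have h4 : ∀ i, 0 < x i := fun i => Set.mem_iInter.1 hx' i
    simp only [Set.mem_ofPred_eq, hfdef, if_pos h4]
    exact h3
  rw [essSup_eq_sInf]
  have : {b | volume {x | b < f x} = 0} = Set.Ici (c * a ^ (-β)) := by
    ext b
    simp only [Set.mem_ofPred_eq, Set.mem_Ici]
    constructor
    · intro h
      by_contra hlt
      exact key b (not_le.1 hlt) h
    · intro h
      have : {x | b < f x} = ∅ := by
        ext x; simpa using (hle x).trans h
      rw [this]; simp
  rw [this, csInf_Ici]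

/-- For a > 0 and β > n, the multivariate Pareto density
f(x) = Z⁻¹ (a + Σ xᵢ)^{-β} on the positive orthant, Z = a^{n-β}/((β-1)⋯(β-n)),
satisfies h(f) + log ‖f‖_∞ = β Σ_{i=1}^n 1/(β-i). -/
theorem pareto_entropy
    (n : ℕ) (hn : 0 < n) (a β : ℝ) (ha : 0 < a) (hβ : (n : ℝ) < β)
    (Z : ℝ) (hZ : Z = a ^ ((n : ℝ) - β) / ∏ i : Fin n, (β - (i + 1 : ℕ)))
    (f : EuclideanSpace ℝ (Fin n) → ℝ)
    (hfdef : f = fun x =>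
      if ∀ i, 0 < x i then Z⁻¹ * (a + ∑ i, x i) ^ (-β) else 0)
    : (-∫ x, f x * Real.log (f x)) + Real.log (essSup f volume)
        = β * ∑ i : Fin n, 1 / (β - (i + 1 : ℕ)) := by
  have hβ0 : 0 < β := lt_of_le_of_lt (Nat.cast_nonneg n) hβ
  have hP : 0 < ∏ i : Fin n, (β - (i + 1 : ℕ)) := by
    refine Finset.prod_pos fun i _ => ?_
    have : ((i + 1 : ℕ) : ℝ) ≤ n := by exact_mod_cast i.2
    linarith
  have hZ0 : 0 < Z := by rw [hZ]; positivity
  rw [essSup_val n ha hβ0 (inv_pos.2 hZ0) f hfdef]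
  set G : (Fin n → ℝ) → ℝ := fun x =>
    Z⁻¹ * (a + ∑ i, x i) ^ (-β) * log (Z⁻¹ * (a + ∑ i, x i) ^ (-β)) with hG
  set O : Set (Fin n → ℝ) := Set.univ.pi fun _ => Set.Ioi 0 with hO
  have hOm : MeasurableSet O := MeasurableSet.univ_pi fun _ => measurableSet_Ioi
  have e1 : ∫ x, f x * Real.log (f x) = ∫ x, G x ∂(orthM n) := by
    have h1 : ∀ x : EuclideanSpace ℝ (Fin n), f x * log (f x) = (O.indicator G) (WithLp.ofLp x) := by
      intro x
      by_cases hx : ∀ i, 0 < x i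
      · have hx' : WithLp.ofLp x ∈ O := fun i _ => hx i
        rw [Set.indicator_of_mem hx', hfdef]
        simp only [if_pos hx, hG]
      · have hx' : WithLp.ofLp x ∉ O := fun h => hx fun i => h i (Set.mem_univ i)
        rw [Set.indicator_of_notMem hx', hfdef]
        simp only [if_neg hx, zero_mul]
    simp_rw [h1]
    rw [(PiLp.volume_preserving_ofLp (Fin n)).integral_comp
      (MeasurableEquiv.toLp 2 (Fin n → ℝ)).symm.measurableEmbedding, integral_indicator hOm,
      hO, volume_pi, Measure.restrict_pi_pi]
  have e2 : ∫ x, G x ∂(orthM n) = ∫ x, ((Z⁻¹ * log Z⁻¹) * (a + ∑ i, x i) ^ (-β)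
      + (-(Z⁻¹ * β)) * ((a + ∑ i, x i) ^ (-β) * log (a + ∑ i, x i))) ∂(orthM n) := by
    refine integral_congr_ae ?_
    filter_upwards [orthM_pos n] with y hy
    have h0 : 0 ≤ ∑ i, y i := Finset.sum_nonneg fun i _ => (hy i).le
    have h1 : 0 < a + ∑ i, y i := by linarith
    simp only [hG]
    rw [log_mul (inv_pos.2 hZ0).ne' (rpow_pos_of_pos h1 _).ne', log_rpow h1]
    ring
  rw [e1, e2, integral_add ((pow_main n a β ha hβ).1.const_mul _) ((log_int n ha hβ).const_mul _),
    integral_const_mul, integral_const_mul, (pow_main n a β ha hβ).2, log_main n a β ha hβ, ← hZ,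
    log_mul (inv_pos.2 hZ0).ne' (rpow_pos_of_pos ha _).ne', log_rpow ha]
  field_simp
  ring
end

section
/- Let X in R^n have density f = φ^{-β} with φ positive convex on an open convex set Ω and β ≥ n+1. Then h(X) + log ‖f‖_∞ ≤ β Σ_{i=1}^n 1/(β - i); that is, among such densities with fixed maximum, entropy is maximized by the n-dimensional Pareto distribution. -/
open MeasureTheory Real Classical

lemma par_log_bound (ε : ℝ) (hε : 0 < ε) (t : ℝ) (ht : 1 < t) : |Real.log t| ≤ t ^ ε / ε := by
  rw [abs_of_nonneg (Real.log_nonneg ht.le)]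
  exact Real.log_le_rpow_div (by linarith) hε

lemma par_pow_bound (n : ℕ) (t : ℝ) (ht : 1 < t) : |(t - 1) ^ n| ≤ t ^ (n : ℝ) := by
  rw [abs_of_nonneg (by have : 0 < t - 1 := by linarith
                        positivity), Real.rpow_natCast]
  exact pow_le_pow_left₀ (by linarith) (by linarith) n

lemma par_intA (n : ℕ) (β : ℝ) (hβ : (n : ℝ) < β) :
    IntegrableOn (fun t : ℝ => (t - 1) ^ n * t ^ (-β - 1)) (Set.Ioi 1) := by
  have h := integrableOn_Ioi_rpow_of_lt (a := (n : ℝ) + (-β - 1)) (by linarith) (zero_lt_one)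
  refine Integrable.mono' h (by fun_prop) ?_
  filter_upwards [ae_restrict_mem measurableSet_Ioi] with t ht
  have ht1 : 1 < t := ht
  have h0 : 0 < t := by linarith
  rw [Real.rpow_add h0, norm_mul, Real.norm_eq_abs, Real.norm_eq_abs, abs_of_nonneg (a := t ^ (-β - 1)) (by positivity)]
  gcongr
  exact par_pow_bound n t ht1

lemma par_intL (n : ℕ) (β : ℝ) (hβ : (n : ℝ) < β) :
    IntegrableOn (fun t : ℝ => (t - 1) ^ n * t ^ (-β - 1) * Real.log t) (Set.Ioi 1) := by
  set ε := (β - n) / 2 with hε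
  have hε0 : 0 < ε := by rw [hε]; linarith
  have h := (integrableOn_Ioi_rpow_of_lt (a := (n : ℝ) + (-β - 1) + ε) (by linarith) (zero_lt_one)).div_const ε
  refine Integrable.mono' h (by fun_prop) ?_
  filter_upwards [ae_restrict_mem measurableSet_Ioi] with t ht
  have ht1 : 1 < t := ht
  have h0 : 0 < t := by linarith
  rw [Real.rpow_add h0, Real.rpow_add h0, norm_mul, norm_mul, Real.norm_eq_abs, Real.norm_eq_abs, Real.norm_eq_abs,
    abs_of_nonneg (a := t ^ (-β - 1)) (by positivity), mul_div_assoc]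
  gcongr
  · exact par_pow_bound n t ht1
  · exact par_log_bound ε hε0 t ht1

lemma par_tendA (n : ℕ) (β : ℝ) (hβ : (n : ℝ) < β) :
    Filter.Tendsto (fun t : ℝ => (t - 1) ^ n * t ^ (-β)) Filter.atTop (nhds 0) := by
  have h := tendsto_rpow_neg_atTop (y := β - n) (by linarith)
  refine squeeze_zero_norm' ?_ h
  filter_upwards [Filter.eventually_gt_atTop 1] with t ht1
  have h0 : 0 < t := by linarith
  rw [show -(β - n) = (n : ℝ) + (-β) by ring, Real.rpow_add h0, norm_mul, Real.norm_eq_abs, Real.norm_eq_abs, abs_of_nonneg (a := t ^ (-β)) (by positivity)]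
  gcongr
  exact par_pow_bound n t ht1

lemma par_tendL (n : ℕ) (β : ℝ) (hβ : (n : ℝ) < β) :
    Filter.Tendsto (fun t : ℝ => (t - 1) ^ n * t ^ (-β) * Real.log t) Filter.atTop (nhds 0) := by
  set ε := (β - n) / 2 with hε
  have hε0 : 0 < ε := by rw [hε]; linarith
  have h := (tendsto_rpow_neg_atTop (y := ε) hε0).div_const ε
  rw [zero_div] at h
  refine squeeze_zero_norm' ?_ h
  filter_upwards [Filter.eventually_gt_atTop 1] with t ht1
  have h0 : 0 < t := by linarith
  rw [show -ε = (n : ℝ) + (-β) + ε by rw [hε]; ring, Real.rpow_add h0, Real.rpow_add h0, norm_mul, norm_mul, Real.norm_eq_abs, Real.norm_eq_abs, Real.norm_eq_abs, abs_of_nonneg (a := t ^ (-β)) (by positivity), mul_div_assoc]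
  gcongr
  · exact par_pow_bound n t ht1
  · exact par_log_bound ε hε0 t ht1

lemma par_dpow (n : ℕ) (t : ℝ) :
    HasDerivAt (fun t : ℝ => (t - 1) ^ (n + 1)) (((n : ℝ) + 1) * (t - 1) ^ n) t := by
  have h := ((hasDerivAt_id t).sub_const 1).fun_pow (n + 1)
  simpa using h

lemma par_recA (n : ℕ) (β : ℝ) (hβ : (n : ℝ) + 1 < β) :
    ((n : ℝ) + 1) * ∫ t in Set.Ioi (1 : ℝ), (t - 1) ^ n * t ^ (-(β - 1) - 1)
      = β * ∫ t in Set.Ioi (1 : ℝ), (t - 1) ^ (n + 1) * t ^ (-β - 1) := by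
  have i1 := (par_intA n (β - 1) (by linarith)).const_mul ((n : ℝ) + 1)
  have i2 := (par_intA (n + 1) β (by push_cast; linarith)).const_mul β
  have h := integral_Ioi_of_hasDerivAt_of_tendsto' (a := 1) (m := 0)
    (f := fun t : ℝ => (t - 1) ^ (n + 1) * t ^ (-β))
    (f' := fun t : ℝ => ((n : ℝ) + 1) * ((t - 1) ^ n * t ^ (-(β - 1) - 1)) - β * ((t - 1) ^ (n + 1) * t ^ (-β - 1)))
    ?_ (i1.sub i2) (par_tendA (n + 1) β (by push_cast; linarith))
  · rw [integral_sub i1 i2, integral_const_mul, integral_const_mul] at h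
    simp at h
    simp
    linarith
  · intro t ht
    have h0 : 0 < t := lt_of_lt_of_le one_pos ht
    refine HasDerivAt.congr_deriv ((par_dpow n t).mul (Real.hasDerivAt_rpow_const (p := -β) (Or.inl h0.ne'))) ?_
    simp
    ring_nf

lemma par_recL (n : ℕ) (β : ℝ) (hβ : (n : ℝ) + 1 < β) :
    ((n : ℝ) + 1) * ∫ t in Set.Ioi (1 : ℝ), (t - 1) ^ n * t ^ (-(β - 1) - 1) * Real.log t
      = β * (∫ t in Set.Ioi (1 : ℝ), (t - 1) ^ (n + 1) * t ^ (-β - 1) * Real.log t)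
        - ∫ t in Set.Ioi (1 : ℝ), (t - 1) ^ (n + 1) * t ^ (-β - 1) := by
  have i1 := (par_intL n (β - 1) (by linarith)).const_mul ((n : ℝ) + 1)
  have i2 := (par_intL (n + 1) β (by push_cast; linarith)).const_mul β
  have i3 := (par_intA (n + 1) β (by push_cast; linarith))
  have h := integral_Ioi_of_hasDerivAt_of_tendsto' (a := 1) (m := 0)
    (f := fun t : ℝ => (t - 1) ^ (n + 1) * t ^ (-β) * Real.log t)
    (f' := fun t : ℝ => ((n : ℝ) + 1) * ((t - 1) ^ n * t ^ (-(β - 1) - 1) * Real.log t) - (β * ((t - 1) ^ (n + 1) * t ^ (-β - 1) * Real.log t) - (t - 1) ^ (n + 1) * t ^ (-β - 1)))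
    ?_ (i1.sub (i2.sub i3)) (par_tendL (n + 1) β (by push_cast; linarith))
  · rw [integral_sub (g := fun t : ℝ => (β * ((t - 1) ^ (n + 1) * t ^ (-β - 1) * Real.log t) - (t - 1) ^ (n + 1) * t ^ (-β - 1))) i1 (i2.sub i3), integral_sub i2 i3, integral_const_mul, integral_const_mul] at h
    simp at h
    simp
    linarith
  · intro t ht
    have h0 : 0 < t := lt_of_lt_of_le one_pos ht
    refine HasDerivAt.congr_deriv (((par_dpow n t).mul (Real.hasDerivAt_rpow_const (p := -β) (Or.inl h0.ne'))).mul (Real.hasDerivAt_log h0.ne')) ?_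
    have : t ^ (-β - 1) = t ^ (-β) * t⁻¹ := by rw [Real.rpow_sub h0, Real.rpow_one]; rfl
    simp [this]
    ring_nf

lemma par_H (β D u : ℝ) (hβ : 0 < β) (hu : 1 ≤ u) :
    IntegrableOn (fun t : ℝ => t ^ (-β - 1) * (β * (Real.log t + D) - 1)) (Set.Ioi u) ∧
    ∫ t in Set.Ioi u, t ^ (-β - 1) * (β * (Real.log t + D) - 1) = u ^ (-β) * (Real.log u + D) := by
  have hi : IntegrableOn (fun t : ℝ => t ^ (-β - 1) * (β * (Real.log t + D) - 1)) (Set.Ioi u) := by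
    have i1 := (par_intL 0 β (by simpa using hβ)).const_mul β
    have i2 := (par_intA 0 β (by simpa using hβ)).const_mul (β * D - 1)
    refine IntegrableOn.mono_set ?_ (Set.Ioi_subset_Ioi hu)
    refine (i1.add i2).congr (Filter.Eventually.of_forall fun t => ?_)
    simp
    ring
  refine ⟨hi, ?_⟩
  have t1 := par_tendL 0 β (by simpa using hβ)
  have t2 := (par_tendA 0 β (by simpa using hβ)).mul_const D
  have h := integral_Ioi_of_hasDerivAt_of_tendsto' (a := u) (m := 0)
    (f := fun t : ℝ => -(t ^ (-β) * (Real.log t + D))) (f' := fun t : ℝ => t ^ (-β - 1) * (β * (Real.log t + D) - 1)) ?_ hi ?_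
  · rw [h]; ring
  · intro t ht
    have h0 : 0 < t := lt_of_lt_of_le one_pos (hu.trans ht)
    refine HasDerivAt.congr_deriv ((Real.hasDerivAt_rpow_const (p := -β) (Or.inl h0.ne')).mul ((Real.hasDerivAt_log h0.ne').add_const D)).neg ?_
    have : t ^ (-β - 1) = t ^ (-β) * t⁻¹ := by rw [Real.rpow_sub h0, Real.rpow_one]; rfl
    simp [this]
    ring_nf
  · convert (t1.add t2).neg using 2
    · simp; ring
    · simp

lemma par_AL (n : ℕ) : ∀ (β : ℝ) (_ : (n : ℝ) < β),
    β * ∫ t in Set.Ioi (1 : ℝ), (t - 1) ^ n * t ^ (-β - 1) * Real.log t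
      = (β * (∑ i : Fin n, 1 / (β - (i + 1 : ℕ))) + 1) * ∫ t in Set.Ioi (1 : ℝ), (t - 1) ^ n * t ^ (-β - 1) := by
  induction n with
  | zero =>
    intro β hβ
    have hβ0 : 0 < β := by simpa using hβ
    have h := (par_H β 0 1 hβ0 le_rfl).2
    have i1 := (par_intL 0 β hβ).const_mul β
    have i2 := (par_intA 0 β hβ)
    have e : ∀ t : ℝ, t ^ (-β - 1) * (β * (Real.log t + 0) - 1) = β * ((t-1)^0 * t ^ (-β - 1) * Real.log t) - (t-1)^0 * t ^ (-β - 1) := by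
      intro t; simp; ring
    simp only [e] at h
    rw [integral_sub i1 i2, integral_const_mul] at h
    simp at h
    simp
    linarith
  | succ n ih =>
    intro β hβ
    push_cast at hβ
    have hn0 : (0 : ℝ) ≤ n := Nat.cast_nonneg n
    have h1 := par_recA n β hβ
    have h2 := par_recL n β hβ
    have h3 := ih (β - 1) (by linarith)
    have hb : β - 1 ≠ 0 := by linarith
    rw [Fin.sum_univ_succ]
    have e : ∀ i : Fin n, 1 / (β - ((i.succ : Fin (n+1)) + 1 : ℕ)) = 1 / (β - 1 - (i + 1 : ℕ)) := by
      intro i; congr 1; simp; ring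
    simp only [e]
    set S := ∑ i : Fin n, 1 / (β - 1 - (i + 1 : ℕ))
    have h4 : ∫ t in Set.Ioi (1 : ℝ), (t - 1) ^ n * t ^ (-(β - 1) - 1) * Real.log t = (S + 1 / (β - 1)) * ∫ t in Set.Ioi (1 : ℝ), (t - 1) ^ n * t ^ (-(β - 1) - 1) := by
      apply mul_left_cancel₀ hb
      rw [h3]; field_simp
    rw [h4] at h2
    have e0 : (1 / (β - (((0 : Fin (n+1)) : ℕ) + 1 : ℕ)) : ℝ) = 1 / (β - 1) := by simp
    rw [e0]
    linear_combination (-1) * h2 + (S + 1 / (β - 1)) * h1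

lemma par_zero (n : ℕ) (β : ℝ) (hβ : (n : ℝ) < β) :
    IntegrableOn (fun t : ℝ => t ^ (-β - 1) * (β * (Real.log t + -(∑ i : Fin n, 1 / (β - (i + 1 : ℕ)))) - 1) * (t - 1) ^ n) (Set.Ioi 1) ∧
    ∫ t in Set.Ioi (1 : ℝ), t ^ (-β - 1) * (β * (Real.log t + -(∑ i : Fin n, 1 / (β - (i + 1 : ℕ)))) - 1) * (t - 1) ^ n = 0 := by
  have h := par_AL n β hβ
  set C := ∑ i : Fin n, 1 / (β - (i + 1 : ℕ))
  have i1 := (par_intL n β hβ).const_mul β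
  have i2 := (par_intA n β hβ).const_mul (β * C + 1)
  have e : (fun t : ℝ => t ^ (-β - 1) * (β * (Real.log t + -C) - 1) * (t - 1) ^ n) = fun t => β * ((t-1)^n * t ^ (-β - 1) * Real.log t) - (β * C + 1) * ((t-1)^n * t ^ (-β - 1)) := by
    funext t; ring
  rw [e]
  refine ⟨i1.sub i2, ?_⟩
  rw [integral_sub i1 i2, integral_const_mul, integral_const_mul, h, sub_self]

lemma par_layer {α : Type*} [MeasurableSpace α] (μ : Measure α) [SFinite μ] (X : α → ℝ)
    (hX : Measurable X) (hX1 : ∀ x, 1 ≤ X x) (β D : ℝ) (hβ : 0 < β)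
    (h1 : Integrable (fun x => X x ^ (-β)) μ)
    (h2 : Integrable (fun x => X x ^ (-β) * Real.log (X x)) μ) :
    IntegrableOn (fun t => t ^ (-β - 1) * (β * (Real.log t + D) - 1) * μ.real {x | X x < t}) (Set.Ioi 1) ∧
    ∫ x, X x ^ (-β) * (Real.log (X x) + D) ∂μ =
      ∫ t in Set.Ioi (1 : ℝ), t ^ (-β - 1) * (β * (Real.log t + D) - 1) * μ.real {x | X x < t} := by
  set k : ℝ → ℝ := fun t => t ^ (-β - 1) * (β * (Real.log t + D) - 1) with hk
  have hkm : Measurable k := by fun_prop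
  set F : α × ℝ → ℝ := {p : α × ℝ | X p.1 < p.2}.indicator (fun p => k p.2) with hF
  have hFm : Measurable F :=
    (hkm.comp measurable_snd).indicator (measurableSet_lt (hX.comp measurable_fst) measurable_snd)
  have hFx : ∀ x, (fun t => F (x, t)) = (Set.Ioi (X x)).indicator k := by
    intro x; funext t; simp [hF, Set.indicator]
  have hFt : ∀ t, (fun x => F (x, t)) = {x | X x < t}.indicator (fun _ => k t) := by
    intro t; funext t; simp [hF, Set.indicator]
  have hinter : ∀ x, Set.Ioi 1 ∩ Set.Ioi (X x) = Set.Ioi (X x) := by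
    intro x; exact Set.inter_eq_right.2 (Set.Ioi_subset_Ioi (hX1 x))
  have hFint : Integrable F (μ.prod (volume.restrict (Set.Ioi 1))) := by
    rw [integrable_prod_iff hFm.aestronglyMeasurable]
    constructor
    · refine Filter.Eventually.of_forall fun x => ?_
      rw [hFx]
      exact IntegrableOn.integrable_indicator ((par_H β D (X x) hβ (hX1 x)).1.mono_measure Measure.restrict_le_self) measurableSet_Ioi
    · set D' := |D| + 2 / β with hD'
      have hb : Integrable (fun x => X x ^ (-β) * (Real.log (X x) + D')) μ := by
        refine (h2.add (h1.mul_const D')).congr (Filter.Eventually.of_forall fun x => ?_)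
        simp; ring
      refine Integrable.mono' hb hFm.aestronglyMeasurable.norm.integral_prod_right' ?_
      refine Filter.Eventually.of_forall fun x => ?_
      rw [← (par_H β D' (X x) hβ (hX1 x)).2, Real.norm_eq_abs, abs_of_nonneg (integral_nonneg fun t => norm_nonneg _)]
      have e : (fun t => ‖F (x, t)‖) = (Set.Ioi (X x)).indicator (fun t => ‖k t‖) := by
        funext t
        rw [show F (x, t) = (Set.Ioi (X x)).indicator k t from congrFun (hFx x) t]
        exact norm_indicator_eq_indicator_norm k t
      rw [e, setIntegral_indicator measurableSet_Ioi, hinter]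
      refine setIntegral_mono_on (par_H β D (X x) hβ (hX1 x)).1.norm (par_H β D' (X x) hβ (hX1 x)).1 measurableSet_Ioi ?_
      intro t ht
      have ht1 : 1 < t := lt_of_le_of_lt (hX1 x) ht
      have h0 : 0 < t := by linarith
      have hl := Real.log_nonneg ht1.le
      simp only [hk]
      rw [norm_mul, Real.norm_eq_abs, Real.norm_eq_abs, abs_of_nonneg (a := t ^ (-β - 1)) (by positivity)]
      gcongr
      have hc : β * D' = β * |D| + 2 := by rw [hD']; field_simp
      have hp1 : β * D ≤ β * |D| := by gcongr; exact le_abs_self D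
      have hp2 : -(β * D) ≤ β * |D| := by rw [← mul_neg]; gcongr; exact neg_le_abs D
      have hp3 : 0 ≤ β * Real.log t := by positivity
      rw [abs_le]; constructor <;> nlinarith
  have e1 : ∀ t, ∫ x, F (x, t) ∂μ = k t * μ.real {x | X x < t} := by
    intro t
    rw [hFt, integral_indicator (measurableSet_lt hX measurable_const)]
    simp [mul_comm]
  have e2 : ∀ x, ∫ t in Set.Ioi 1, F (x, t) = X x ^ (-β) * (Real.log (X x) + D) := by
    intro x
    rw [hFx, setIntegral_indicator measurableSet_Ioi, hinter]
    exact (par_H β D (X x) hβ (hX1 x)).2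
  constructor
  · have := hFint.integral_prod_right
    simp only [e1] at this; exact this
  · have := integral_integral_swap (f := fun x t => F (x, t)) hFint
    simpa only [e1, e2] using this

lemma par_scaling {n : ℕ} {Ω : Set (EuclideanSpace ℝ (Fin n))} {φ : EuclideanSpace ℝ (Fin n) → ℝ}
    (hφ : ConvexOn ℝ Ω φ) (m : ℝ) (happ : ∀ ε > 0, ∃ x ∈ Ω, φ x < m + ε)
    (hfin : ∀ t, volume {x | x ∈ Ω ∧ φ x < t} ≠ ⊤) {a t : ℝ} (hma : m < a) (hat : a ≤ t) :
    ((a - m) / (t - m)) ^ n * volume.real {x | x ∈ Ω ∧ φ x < t} ≤ volume.real {x | x ∈ Ω ∧ φ x < a} := by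
  set r := (a - m) / (t - m) with hr
  have htm : 0 < t - m := by linarith
  have hr0 : 0 < r := div_pos (by linarith) htm
  have hr1 : r ≤ 1 := (div_le_one htm).2 (by linarith)
  have key : ∀ l, 0 < l → l < r → l ^ n * volume.real {x | x ∈ Ω ∧ φ x < t} ≤ volume.real {x | x ∈ Ω ∧ φ x < a} := by
    intro l hl hlr
    have hε : 0 < a - m - l * (t - m) := by
      have := (lt_div_iff₀ htm).1 hlr
      linarith
    obtain ⟨x0, hx0, hx0'⟩ := happ _ hε
    have hsub : AffineMap.homothety x0 l '' {x | x ∈ Ω ∧ φ x < t} ⊆ {x | x ∈ Ω ∧ φ x < a} := by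
      rintro _ ⟨y, ⟨hy, hyt⟩, rfl⟩
      have e : AffineMap.homothety x0 l y = (1 - l) • x0 + l • y := by
        simp [AffineMap.homothety_apply, smul_sub, sub_smul]; abel
      have hl1 : 0 < 1 - l := by linarith
      rw [e]
      refine ⟨hφ.1 hx0 hy hl1.le hl.le (by ring), ?_⟩
      have := hφ.2 hx0 hy hl1.le hl.le (by ring)
      simp only [smul_eq_mul] at this
      nlinarith [mul_lt_mul_of_pos_left hx0' hl1, mul_lt_mul_of_pos_left hyt hl, mul_pos hl hε]
    have hm := ENNReal.toReal_mono (hfin a) (measure_mono (μ := volume) hsub)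
    rw [Measure.addHaar_image_homothety, ENNReal.toReal_mul, finrank_euclideanSpace_fin,
      ENNReal.toReal_ofReal (abs_nonneg _), abs_of_nonneg (by positivity)] at hm
    exact hm
  have hc : Filter.Tendsto (fun l : ℝ => l ^ n * volume.real {x | x ∈ Ω ∧ φ x < t}) (nhdsWithin r (Set.Iio r))
      (nhds (r ^ n * volume.real {x | x ∈ Ω ∧ φ x < t})) := by
    have : Continuous (fun l : ℝ => l ^ n * volume.real {x | x ∈ Ω ∧ φ x < t}) := by fun_prop
    exact (this.tendsto r).mono_left nhdsWithin_le_nhds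
  refine le_of_tendsto hc ?_
  filter_upwards [Ioo_mem_nhdsLT hr0] with l hl
  exact key l hl.1 hl.2

lemma par_level {n : ℕ} {Ω : Set (EuclideanSpace ℝ (Fin n))} (hΩ : IsOpen Ω) {φ : EuclideanSpace ℝ (Fin n) → ℝ}
    (hφ : ConvexOn ℝ Ω φ) (hpos : ∀ x ∈ Ω, 0 < φ x) (β : ℝ) (hβ : 0 < β)
    (h1 : IntegrableOn (fun x => φ x ^ (-β)) Ω) (t : ℝ) :
    volume {x | x ∈ Ω ∧ φ x < t} ≠ ⊤ ∧
      (0 < t → t ^ (-β) * volume.real {x | x ∈ Ω ∧ φ x < t} ≤ ∫ x in Ω, φ x ^ (-β)) := by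
  have hop : IsOpen {x | x ∈ Ω ∧ φ x < t} := (hφ.continuousOn hΩ).isOpen_inter_preimage hΩ isOpen_Iio
  have hsub : {x | x ∈ Ω ∧ φ x < t} ⊆ Ω := fun x hx => hx.1
  rcases le_or_gt t 0 with ht | ht
  · have : {x | x ∈ Ω ∧ φ x < t} = ∅ := by
      ext x; simp; intro hx; linarith [hpos x hx]
    rw [this]; simp; intro h; linarith
  have hle : ∀ x ∈ {x | x ∈ Ω ∧ φ x < t}, t ^ (-β) ≤ φ x ^ (-β) := fun x hx =>
    Real.rpow_le_rpow_of_nonpos (hpos x hx.1) hx.2.le (by linarith)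
  have htp : 0 < t ^ (-β) := by positivity
  have hfin : volume {x | x ∈ Ω ∧ φ x < t} ≠ ⊤ := by
    have hi : IntegrableOn (fun _ => t ^ (-β)) {x | x ∈ Ω ∧ φ x < t} := by
      refine Integrable.mono' (h1.mono_set hsub) (by fun_prop) ?_
      filter_upwards [ae_restrict_mem hop.measurableSet] with x hx
      rw [Real.norm_eq_abs, abs_of_pos htp]
      exact hle x hx
    rw [integrableOn_const_iff] at hi
    rcases hi with h | h
    · simp at h; linarith
    · exact h.ne
  refine ⟨hfin, fun _ => ?_⟩
  calc t ^ (-β) * volume.real {x | x ∈ Ω ∧ φ x < t} = ∫ x in {x | x ∈ Ω ∧ φ x < t}, t ^ (-β) := by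
        simp [mul_comm]
    _ ≤ ∫ x in {x | x ∈ Ω ∧ φ x < t}, φ x ^ (-β) :=
        setIntegral_mono_on (integrableOn_const hfin) (h1.mono_set hsub) hop.measurableSet hle
    _ ≤ _ := setIntegral_mono_set h1 (by
        filter_upwards [ae_restrict_mem hΩ.measurableSet] with x hx
        have := hpos x hx
        simp; positivity) hsub.eventuallyLE

lemma par_core (n : ℕ) (β : ℝ) (hβ : (n : ℝ) < β)
    (Ω : Set (EuclideanSpace ℝ (Fin n))) (hΩ : IsOpen Ω)
    (φ : EuclideanSpace ℝ (Fin n) → ℝ) (hφ1 : ∀ x ∈ Ω, 1 ≤ φ x) (hφ : ConvexOn ℝ Ω φ)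
    (happ : ∀ ε > 0, ∃ x ∈ Ω, φ x < 1 + ε)
    (h1 : IntegrableOn (fun x => φ x ^ (-β)) Ω)
    (h2 : IntegrableOn (fun x => φ x ^ (-β) * Real.log (φ x)) Ω) :
    ∫ x in Ω, φ x ^ (-β) * (Real.log (φ x) + -(∑ i : Fin n, 1 / (β - (i + 1 : ℕ)))) ≤ 0 := by
  have hβ0 : 0 < β := lt_of_le_of_lt (Nat.cast_nonneg n) hβ
  have hz := par_zero n β hβ
  have hC : 0 ≤ ∑ i : Fin n, 1 / (β - (i + 1 : ℕ)) := by
    refine Finset.sum_nonneg fun i _ => ?_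
    have : ((i + 1 : ℕ) : ℝ) ≤ n := by exact_mod_cast i.2
    apply div_nonneg zero_le_one; linarith
  set C := ∑ i : Fin n, 1 / (β - (i + 1 : ℕ))
  have hpos : ∀ x ∈ Ω, 0 < φ x := fun x hx => lt_of_lt_of_le one_pos (hφ1 x hx)
  set X : EuclideanSpace ℝ (Fin n) → ℝ := fun x => if x ∈ Ω then φ x else 1 with hX
  have hXm : Measurable X := by
    refine measurable_of_isOpen fun U hU => ?_
    have hop := (hφ.continuousOn hΩ).isOpen_inter_preimage hΩ hU
    have e : X ⁻¹' U = (Ω ∩ φ ⁻¹' U) ∪ (Ωᶜ ∩ {_x | (1:ℝ) ∈ U}) := by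
      ext x; by_cases hx : x ∈ Ω <;> simp [hX, hx]
    rw [e]
    exact hop.measurableSet.union (hΩ.measurableSet.compl.inter (MeasurableSet.const _))
  have hX1 : ∀ x, 1 ≤ X x := by
    intro x; by_cases hx : x ∈ Ω <;> simp [hX, hx]; exact hφ1 x hx
  have hXΩ : ∀ x ∈ Ω, X x = φ x := fun x hx => by simp [hX, hx]
  have g1 : IntegrableOn (fun x => X x ^ (-β)) Ω :=
    h1.congr_fun (fun x hx => by simp only [hXΩ x hx]) hΩ.measurableSet
  have g2 : IntegrableOn (fun x => X x ^ (-β) * Real.log (X x)) Ω :=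
    h2.congr_fun (fun x hx => by simp only [hXΩ x hx]) hΩ.measurableSet
  have hL := par_layer (volume.restrict Ω) X hXm hX1 β (-C) hβ0 g1 g2
  have hV : ∀ t, (volume.restrict Ω).real {x | X x < t} = volume.real {x | x ∈ Ω ∧ φ x < t} := by
    intro t
    rw [measureReal_restrict_apply (measurableSet_lt hXm measurable_const)]
    congr 1
    ext x
    simp only [Set.mem_inter_iff, Set.mem_ofPred_eq]
    constructor
    · rintro ⟨h, hx⟩; rw [hXΩ x hx] at h; exact ⟨hx, h⟩
    · rintro ⟨hx, h⟩; rw [hXΩ x hx]; exact ⟨h, hx⟩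
  simp only [hV] at hL
  have e : ∫ x in Ω, φ x ^ (-β) * (Real.log (φ x) + -C) = ∫ x in Ω, X x ^ (-β) * (Real.log (X x) + -C) :=
    setIntegral_congr_fun hΩ.measurableSet (fun x hx => by simp only [hXΩ x hx])
  rw [e, hL.2]
  have hfin := fun t => (par_level hΩ hφ hpos β hβ0 h1 t).1
  set t0 := Real.exp (C + 1 / β) with ht0
  have ht01 : 1 < t0 := Real.one_lt_exp_iff.2 (by positivity)
  set V : ℝ → ℝ := fun t => volume.real {x | x ∈ Ω ∧ φ x < t} with hVdef
  set c0 := V t0 / (t0 - 1) ^ n with hc0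
  calc _ ≤ ∫ t in Set.Ioi (1 : ℝ), t ^ (-β - 1) * (β * (Real.log t + -C) - 1) * (t - 1) ^ n * c0 := by
        refine setIntegral_mono_on hL.1 (hz.1.mul_const c0) measurableSet_Ioi ?_
        intro t ht
        have ht1 : 1 < t := ht
        have h0 : 0 < t := by linarith
        have htp : 0 < t ^ (-β - 1) := by positivity
        have hd : 0 < (t - 1) ^ n := pow_pos (by linarith) n
        have hd0 : 0 < (t0 - 1) ^ n := pow_pos (by linarith) n
        rw [mul_assoc _ ((t - 1) ^ n)]
        rcases le_total t t0 with htt | htt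
        · have hlog : Real.log t ≤ C + 1 / β := (Real.log_le_iff_le_exp h0).2 htt
          have hs := par_scaling hφ 1 happ hfin ht1 htt
          apply mul_le_mul_of_nonpos_left
          · rw [hc0]
            refine le_trans (le_of_eq ?_) hs
            rw [div_pow]; simp only [hVdef]; ring
          · apply mul_nonpos_of_nonneg_of_nonpos htp.le
            have : β * (Real.log t + -C) ≤ β * (1 / β) := by gcongr; linarith
            rw [mul_one_div_cancel hβ0.ne'] at this
            linarith
        · have hlog : C + 1 / β ≤ Real.log t := (Real.le_log_iff_exp_le h0).2 htt
          have hs := par_scaling hφ 1 happ hfin ht01 htt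
          apply mul_le_mul_of_nonneg_left
          · rw [hc0, ← mul_div_assoc, le_div_iff₀ hd0]
            rw [div_pow, div_mul_eq_mul_div, div_le_iff₀ hd] at hs
            simp only [hVdef]; linarith
          · apply mul_nonneg htp.le
            have : β * (1 / β) ≤ β * (Real.log t + -C) := by gcongr; linarith
            rw [mul_one_div_cancel hβ0.ne'] at this
            linarith
    _ = 0 := by rw [integral_mul_const, hz.2, zero_mul]
    _ ≤ 0 := le_rfl

lemma par_min_pos (n : ℕ) (β : ℝ) (hβ : (n : ℝ) + 1 ≤ β)
    (Ω : Set (EuclideanSpace ℝ (Fin n))) (hΩ : IsOpen Ω) (hne : Ω.Nonempty)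
    (φ : EuclideanSpace ℝ (Fin n) → ℝ) (hpos : ∀ x ∈ Ω, 0 < φ x) (hφ : ConvexOn ℝ Ω φ)
    (h1 : IntegrableOn (fun x => φ x ^ (-β)) Ω) (hI : ∫ x in Ω, φ x ^ (-β) = 1)
    (happ : ∀ ε > 0, ∃ x ∈ Ω, φ x < 0 + ε) : False := by
  have hβ0 : 0 < β := lt_of_lt_of_le (by positivity) hβ
  obtain ⟨x0, hx0⟩ := hne
  set t := φ x0 + 1 with ht
  have htp : 0 < t := by have := hpos x0 hx0; linarith
  have hfin := fun t => (par_level hΩ hφ hpos β hβ0 h1 t).1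
  have hop : IsOpen {x | x ∈ Ω ∧ φ x < t} := (hφ.continuousOn hΩ).isOpen_inter_preimage hΩ isOpen_Iio
  have hVp : 0 < volume.real {x | x ∈ Ω ∧ φ x < t} :=
    ENNReal.toReal_pos (hop.measure_pos volume ⟨x0, hx0, by linarith⟩).ne' (hfin t)
  set V := volume.real {x | x ∈ Ω ∧ φ x < t}
  set c := V / t ^ n with hc
  have hcp : 0 < c := by positivity
  set a := min (min 1 t) (c / 2) with ha
  have hap : 0 < a := by positivity
  have ha1 : a ≤ 1 := (min_le_left _ _).trans (min_le_left _ _)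
  have hat : a ≤ t := (min_le_left _ _).trans (min_le_right _ _)
  have hac : a ≤ c / 2 := min_le_right _ _
  have hs := par_scaling hφ 0 happ hfin hap hat
  have hl := (par_level hΩ hφ hpos β hβ0 h1 a).2 hap
  rw [hI, Real.rpow_neg hap.le, inv_mul_le_iff₀ (by positivity), mul_one] at hl
  have hr : a ^ β ≤ a ^ (n + 1) := by
    rw [← Real.rpow_natCast]
    exact Real.rpow_le_rpow_of_exponent_ge hap ha1 (by push_cast; exact hβ)
  have h4 : a ^ n * c ≤ a ^ n * a := by
    calc a ^ n * c = ((a - 0) / (t - 0)) ^ n * V := by rw [hc, sub_zero, sub_zero, div_pow]; ring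
      _ ≤ _ := hs
      _ ≤ _ := hl
      _ ≤ _ := hr
      _ = _ := pow_succ a n
  have := le_of_mul_le_mul_left h4 (by positivity)
  linarith

/-- If X in R^n has density f = φ^{-β} on an open convex set Ω, with φ
positive convex and β ≥ n+1, then h(X) + log ‖f‖_∞ ≤ β Σ_{i=1}^n 1/(β-i); i.e. among
such densities with fixed maximum, entropy is maximized by the Pareto distribution. -/
theorem entropy_upper_bound_convex_measure
    (n : ℕ) (hn : 0 < n) (β : ℝ) (hβ : (n : ℝ) + 1 ≤ β)
    (Ω : Set (EuclideanSpace ℝ (Fin n))) (hΩopen : IsOpen Ω) (hΩconv : Convex ℝ Ω)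
    (φ : EuclideanSpace ℝ (Fin n) → ℝ)
    (hφpos : ∀ x ∈ Ω, 0 < φ x) (hφconv : ConvexOn ℝ Ω φ)
    (f : EuclideanSpace ℝ (Fin n) → ℝ)
    (hfdef : f = fun x => if x ∈ Ω then φ x ^ (-β) else 0)
    (hprob : ∫ x, f x = 1)
    (hent : Integrable (fun x => f x * Real.log (f x)))
    : (-∫ x, f x * Real.log (f x)) + Real.log (essSup f volume)
        ≤ β * ∑ i : Fin n, 1 / (β - (i + 1 : ℕ)) := by
  have hβ0 : 0 < β := lt_of_lt_of_le (by positivity) hβ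
  have hΩm := hΩopen.measurableSet
  have hfint : Integrable f := by
    by_contra h
    rw [integral_undef h] at hprob
    exact zero_ne_one hprob
  have hfΩ : ∀ x ∈ Ω, f x = φ x ^ (-β) := fun x hx => by simp [hfdef, hx]
  have hfi : f = Ω.indicator (fun x => φ x ^ (-β)) := by
    funext x; by_cases hx : x ∈ Ω <;> simp [hfdef, hx]
  have hgi : (fun x => f x * Real.log (f x)) = Ω.indicator (fun x => -β * (φ x ^ (-β) * Real.log (φ x))) := by
    funext x
    by_cases hx : x ∈ Ω
    · rw [Set.indicator_of_mem hx, hfΩ x hx, Real.log_rpow (hφpos x hx)]; ring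
    · rw [Set.indicator_of_notMem hx, hfi, Set.indicator_of_notMem hx, zero_mul]
  have h1 : IntegrableOn (fun x => φ x ^ (-β)) Ω := by
    rw [hfi, integrable_indicator_iff hΩm] at hfint; exact hfint
  have hI : ∫ x in Ω, φ x ^ (-β) = 1 := by
    rw [hfi, integral_indicator hΩm] at hprob; exact hprob
  have h2 : IntegrableOn (fun x => φ x ^ (-β) * Real.log (φ x)) Ω := by
    rw [hgi, integrable_indicator_iff hΩm] at hent
    refine (Integrable.const_mul hent (-β)⁻¹).congr (Filter.Eventually.of_forall fun x => ?_)
    simp only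
    rw [inv_mul_cancel_left₀ (by linarith)]
  have hE : ∫ x, f x * Real.log (f x) = -β * ∫ x in Ω, φ x ^ (-β) * Real.log (φ x) := by
    rw [hgi, integral_indicator hΩm, integral_const_mul]
  have hne : Ω.Nonempty := by
    rw [Set.nonempty_iff_ne_empty]; rintro rfl
    simp at hI
  set m := sInf (φ '' Ω) with hm
  have hbdd : BddBelow (φ '' Ω) := ⟨0, by rintro _ ⟨x, hx, rfl⟩; exact (hφpos x hx).le⟩
  have hmle : ∀ x ∈ Ω, m ≤ φ x := fun x hx => csInf_le hbdd ⟨x, hx, rfl⟩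
  have hm0 : 0 ≤ m := le_csInf (hne.image φ) (by rintro _ ⟨x, hx, rfl⟩; exact (hφpos x hx).le)
  have happ : ∀ ε > 0, ∃ x ∈ Ω, φ x < m + ε := by
    intro ε hε
    obtain ⟨_, ⟨x, hx, rfl⟩, h⟩ := exists_lt_of_csInf_lt (hne.image φ) (show sInf (φ '' Ω) < m + ε by linarith)
    exact ⟨x, hx, h⟩
  have hmp : 0 < m := by
    refine lt_of_le_of_ne hm0 fun h => ?_
    rw [← h] at happ
    exact par_min_pos n β hβ Ω hΩopen hne φ hφpos hφconv h1 hI happ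
  -- the normalised convex function
  have hpow : ∀ x ∈ Ω, (m⁻¹ * φ x) ^ (-β) = m⁻¹ ^ (-β) * φ x ^ (-β) := fun x hx =>
    Real.mul_rpow (by positivity) (hφpos x hx).le
  have hlog : ∀ x ∈ Ω, Real.log (m⁻¹ * φ x) = Real.log (φ x) - Real.log m := fun x hx => by
    rw [Real.log_mul (by positivity) (hφpos x hx).ne', Real.log_inv]; ring
  have hcore := par_core n β (by linarith) Ω hΩopen (fun x => m⁻¹ * φ x)
    (fun x hx => by
      rw [inv_mul_eq_div]; exact (one_le_div hmp).2 (hmle x hx))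
    (by simpa [smul_eq_mul] using hφconv.smul (c := m⁻¹) (by positivity))
    (fun ε hε => by
      obtain ⟨x, hx, h⟩ := happ (m * ε) (by positivity)
      refine ⟨x, hx, ?_⟩
      rw [inv_mul_lt_iff₀ hmp]; linarith)
    (IntegrableOn.congr_fun (h1.const_mul (m⁻¹ ^ (-β))) (fun x hx => (hpow x hx).symm) hΩm)
    (IntegrableOn.congr_fun ((h2.sub (h1.mul_const (Real.log m))).const_mul (m⁻¹ ^ (-β)))
      (fun x hx => by simp only [hpow x hx, hlog x hx, Pi.sub_apply]; ring) hΩm)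
  set C := ∑ i : Fin n, 1 / (β - (i + 1 : ℕ))
  have hcalc : ∫ x in Ω, (m⁻¹ * φ x) ^ (-β) * (Real.log (m⁻¹ * φ x) + -C) =
      m⁻¹ ^ (-β) * ((∫ x in Ω, φ x ^ (-β) * Real.log (φ x)) - (Real.log m + C)) := by
    have e : ∫ x in Ω, (m⁻¹ * φ x) ^ (-β) * (Real.log (m⁻¹ * φ x) + -C) =
        ∫ x in Ω, m⁻¹ ^ (-β) * (φ x ^ (-β) * Real.log (φ x) - φ x ^ (-β) * (Real.log m + C)) :=
      setIntegral_congr_fun hΩm (fun x hx => by simp only [hpow x hx, hlog x hx]; ring)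
    rw [e, integral_const_mul, integral_sub h2 (h1.mul_const _), integral_mul_const, hI, one_mul]
  rw [hcalc] at hcore
  have hle : (∫ x in Ω, φ x ^ (-β) * Real.log (φ x)) - (Real.log m + C) ≤ 0 := by
    by_contra h
    push Not at h
    have : 0 < m⁻¹ ^ (-β) := by positivity
    nlinarith [mul_pos this h]
  -- the essential supremum
  have hf0 : ∀ x, 0 ≤ f x := by
    intro x; by_cases hx : x ∈ Ω
    · rw [hfΩ x hx]; exact (Real.rpow_pos_of_pos (hφpos x hx) _).le
    · simp [hfdef, hx]
  have hfle : ∀ x, f x ≤ m ^ (-β) := by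
    intro x; by_cases hx : x ∈ Ω
    · rw [hfΩ x hx]; exact Real.rpow_le_rpow_of_nonpos hmp (hmle x hx) (by linarith)
    · simp [hfdef, hx]; positivity
  have hsup : essSup f volume ≤ m ^ (-β) :=
    essSup_le_of_ae_le _ (Filter.Eventually.of_forall hfle)
      (Filter.isCoboundedUnder_le_of_le _ (x := 0) hf0)
  have hae : ∀ᵐ x, f x ≤ essSup f volume :=
    ae_le_essSup (Filter.isBoundedUnder_of ⟨m ^ (-β), hfle⟩)
  have hsp : 0 < essSup f volume := by
    by_contra h
    push Not at h
    have : ∫ x, f x ≤ 0 := integral_nonpos_of_ae (hae.mono fun x hx => hx.trans h)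
    linarith
  have hlogsup : Real.log (essSup f volume) ≤ -β * Real.log m := by
    rw [← Real.log_rpow hmp]
    exact Real.log_le_log hsp hsup
  rw [hE]
  nlinarith [mul_le_mul_of_nonneg_left hle hβ0.le]
end
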